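/- Fix 0 < p < 1/2 and 0 < R < 1 with R < 1 - log₂(1 + √(4p(1-p))). Let (C_k) be a sequence of binary Reed-Muller codes C_k = RM(m_k, d_k) of lengths N_k = 2^{m_k} with m_k → ∞ and limsup_k rate(C_k) ≤ R. For each k define the error probability P_k = Σ_{e ∈ F₂^{N_k}} p^{wt(e)} (1-p)^{N_k - wt(e)} · 1[∃ c ∈ C_k, c ≠ 0, wt(e + c) ≤ wt(e)]. Then P_k → 0 as k → ∞; that is, C_k decodes errors on the binary symmetric channel BSC(p) with high probability. -/

import Mathlib

open scoped Classical

/-- The Reed-Muller code `RM(m, d) ⊆ F₂^{2^m}`: the set of evaluation vectors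
`(f(x))_{x ∈ F₂^m}` of polynomials `f ∈ F₂[x₁,…,x_m]` of total degree at most `d`.
A codeword is viewed as a function `(Fin m → ZMod 2) → ZMod 2` on the `2^m` points. -/
def RMcode (m d : ℕ) : Set ((Fin m → ZMod 2) → ZMod 2) :=
  {c | ∃ f : MvPolynomial (Fin m) (ZMod 2),
        f.totalDegree ≤ d ∧ c = fun x => MvPolynomial.eval x f}

/-- The rate of `RM(m, d)`: its dimension `Σ_{i=0}^{d} C(m,i)` divided by its length `2^m`. -/
noncomputable def RMrate (m d : ℕ) : ℝ :=
  (∑ i ∈ Finset.range (d + 1), (m.choose i : ℝ)) / 2 ^ m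

/-- Hamming weight of a vector `e ∈ F₂^{2^m}` (viewed as a function on `F₂^m`). -/
def wt {m : ℕ} (e : (Fin m → ZMod 2) → ZMod 2) : ℕ :=
  (Finset.univ.filter fun x => e x ≠ 0).card

/-- The error probability of `RM(m, d)` on `BSC(p)`:
`Σ_e p^{wt(e)} (1-p)^{2^m - wt(e)} · 1[∃ c ∈ RM(m,d), c ≠ 0, wt(e+c) ≤ wt(e)]`. -/
noncomputable def errProb (p : ℝ) (m d : ℕ) : ℝ :=
  ∑ e : (Fin m → ZMod 2) → ZMod 2,
    p ^ wt e * (1 - p) ^ (2 ^ m - wt e) *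
      (if ∃ c ∈ RMcode m d, c ≠ 0 ∧ wt (e + c) ≤ wt e then (1 : ℝ) else 0)

namespace RMBSC

section Expectation

variable {ι κ : Type*} [DecidableEq ι] [DecidableEq κ]

/-- Expectation of `F S` where `S ⊆ J` contains each element of `J` independently with
probability `l`. -/
noncomputable def bexp (l : ℝ) (J : Finset ι) (F : Finset ι → ℝ) : ℝ :=
  ∑ S ∈ J.powerset, (∏ i ∈ J, if i ∈ S then l else 1 - l) * F S

theorem bexp_empty (l : ℝ) (F : Finset ι → ℝ) : bexp l ∅ F = F ∅ := by
  simp [bexp]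

theorem bexp_insert (l : ℝ) {i : ι} {J : Finset ι} (hi : i ∉ J) (F : Finset ι → ℝ) :
    bexp l (insert i J) F = (1 - l) * bexp l J F + l * bexp l J (fun S => F (insert i S)) := by
  unfold bexp
  rw [Finset.sum_powerset_insert hi, Finset.mul_sum, Finset.mul_sum]
  congr 1
  · refine Finset.sum_congr rfl fun S hS => ?_
    have : i ∉ S := fun h => hi (Finset.mem_powerset.1 hS h)
    rw [Finset.prod_insert hi, if_neg this]; ring
  · refine Finset.sum_congr rfl fun S hS => ?_
    rw [Finset.prod_insert hi, if_pos (Finset.mem_insert_self i S)]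
    have : ∏ j ∈ J, (if j ∈ insert i S then l else 1 - l) = ∏ j ∈ J, if j ∈ S then l else 1 - l := by
      refine Finset.prod_congr rfl fun j hj => ?_
      have : j ≠ i := fun h => hi (h ▸ hj)
      simp [this]
    rw [this]; ring

theorem bexp_add (l : ℝ) (J : Finset ι) (F G : Finset ι → ℝ) :
    bexp l J (fun S => F S + G S) = bexp l J F + bexp l J G := by
  simp [bexp, mul_add, Finset.sum_add_distrib]

theorem bexp_const_mul (l : ℝ) (J : Finset ι) (a : ℝ) (F : Finset ι → ℝ) :
    bexp l J (fun S => a * F S) = a * bexp l J F := by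
  simp only [bexp, Finset.mul_sum]
  exact Finset.sum_congr rfl fun _ _ => by ring

theorem bexp_sum {α : Type*} (l : ℝ) (J : Finset ι) (s : Finset α) (F : α → Finset ι → ℝ) :
    bexp l J (fun S => ∑ a ∈ s, F a S) = ∑ a ∈ s, bexp l J (F a) := by
  simp only [bexp, Finset.mul_sum]
  exact Finset.sum_comm

theorem bexp_const (l : ℝ) (J : Finset ι) (a : ℝ) : bexp l J (fun _ => a) = a := by
  induction J using Finset.induction_on with
  | empty => exact bexp_empty _ _
  | insert i J hi ih => rw [bexp_insert l hi, ih]; ring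

variable {l : ℝ}

theorem weight_nonneg (h0 : 0 ≤ l) (h1 : l ≤ 1) (J S : Finset ι) :
    0 ≤ ∏ i ∈ J, if i ∈ S then l else 1 - l :=
  Finset.prod_nonneg fun i _ => by split_ifs <;> linarith

theorem bexp_mono (h0 : 0 ≤ l) (h1 : l ≤ 1) {J : Finset ι} {F G : Finset ι → ℝ}
    (h : ∀ S ⊆ J, F S ≤ G S) : bexp l J F ≤ bexp l J G :=
  Finset.sum_le_sum fun S hS =>
    mul_le_mul_of_nonneg_left (h S (Finset.mem_powerset.1 hS)) (weight_nonneg h0 h1 J S)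

theorem bexp_congr {J : Finset ι} {F G : Finset ι → ℝ} (h : ∀ S ⊆ J, F S = G S) :
    bexp l J F = bexp l J G :=
  Finset.sum_congr rfl fun S hS => by rw [h S (Finset.mem_powerset.1 hS)]

theorem bexp_nonneg (h0 : 0 ≤ l) (h1 : l ≤ 1) {J : Finset ι} {F : Finset ι → ℝ}
    (h : ∀ S, 0 ≤ F S) : 0 ≤ bexp l J F :=
  Finset.sum_nonneg fun S _ => mul_nonneg (weight_nonneg h0 h1 J S) (h S)

theorem bexp_mul_sq_le (h0 : 0 ≤ l) (h1 : l ≤ 1) (J : Finset ι) (F G : Finset ι → ℝ) :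
    bexp l J (fun S => F S * G S) ^ 2 ≤ bexp l J (fun S => F S ^ 2) * bexp l J (fun S => G S ^ 2) :=
  Finset.sum_sq_le_sum_mul_sum_of_sq_le_mul _
    (fun S _ => mul_nonneg (weight_nonneg h0 h1 J S) (sq_nonneg _))
    (fun S _ => mul_nonneg (weight_nonneg h0 h1 J S) (sq_nonneg _)) fun S _ => le_of_eq (by ring)

theorem bexp_preimage (l : ℝ) (φ : κ → ι) (hφ : Function.Injective φ) (J : Finset ι)
    (G : Finset κ → ℝ) :
    bexp l J (fun S => G (S.preimage φ hφ.injOn)) = bexp l (J.preimage φ hφ.injOn) G := by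
  induction J using Finset.induction_on generalizing G with
  | empty => simp [bexp_empty]
  | insert i J hi ih =>
    rw [bexp_insert l hi, ih]
    by_cases h : ∃ a, φ a = i
    · obtain ⟨a, rfl⟩ := h
      have key : ∀ S : Finset ι, (insert (φ a) S).preimage φ hφ.injOn
          = insert a (S.preimage φ hφ.injOn) := fun S => by
        ext b; simp [hφ.eq_iff]
      simp only [key]
      rw [bexp_insert l (by simpa using hi), ih fun S => G (insert a S)]
    · have key : ∀ S : Finset ι, (insert i S).preimage φ hφ.injOn = S.preimage φ hφ.injOn :=
        fun S => by
          ext b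
          have : φ b ≠ i := fun hb => h ⟨b, hb⟩
          simp [this]
      simp only [key, ih]
      ring

theorem bexp_map_equiv [Fintype ι] (l : ℝ) (e : ι ≃ ι) (F : Finset ι → ℝ) :
    bexp l Finset.univ (fun S => F (S.preimage e e.injective.injOn)) = bexp l Finset.univ F := by
  rw [bexp_preimage l e e.injective]
  congr 1
  ext; simp

end Expectation

section Fourier

variable {ι : Type*} [DecidableEq ι]

/-- The biased character attached to `A`. -/
noncomputable def chr (a b : ℝ) (A S : Finset ι) : ℝ := ∏ i ∈ A, if i ∈ S then a else -b

theorem chr_insert_right {a b : ℝ} {i : ι} {A : Finset ι} (hi : i ∉ A) (S : Finset ι) :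
    chr a b A (insert i S) = chr a b A S := by
  refine Finset.prod_congr rfl fun j hj => ?_
  have : j ≠ i := fun h => hi (h ▸ hj)
  simp [this]

theorem chr_insert_insert {a b : ℝ} {i : ι} {A : Finset ι} (hi : i ∉ A) (S : Finset ι) :
    chr a b (insert i A) (insert i S) = a * chr a b A S := by
  rw [← chr_insert_right hi S]
  simp [chr, Finset.prod_insert hi]

theorem chr_insert_left {a b : ℝ} {i : ι} {A S : Finset ι} (hi : i ∉ A) (hS : i ∉ S) :
    chr a b (insert i A) S = -b * chr a b A S := by
  simp [chr, Finset.prod_insert hi, hS]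

/-- Fourier coefficient of `F` at `A`. -/
noncomputable def coef (l a b : ℝ) (J : Finset ι) (F : Finset ι → ℝ) (A : Finset ι) : ℝ :=
  bexp l J fun S => F S * chr a b A S

theorem coef_insert_of_notMem {l a b : ℝ} {i : ι} {J A : Finset ι} (hi : i ∉ J) (hA : i ∉ A)
    (F : Finset ι → ℝ) :
    coef l a b (insert i J) F A
      = (1 - l) * coef l a b J F A + l * coef l a b J (fun S => F (insert i S)) A := by
  unfold coef
  rw [bexp_insert l hi]
  simp only [chr_insert_right hA]

theorem coef_insert_insert {l a b : ℝ} {i : ι} {J A : Finset ι} (hi : i ∉ J) (hA : i ∉ A)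
    (F : Finset ι → ℝ) :
    coef l a b (insert i J) F (insert i A)
      = -((1 - l) * b) * coef l a b J F A
        + l * a * coef l a b J (fun S => F (insert i S)) A := by
  unfold coef
  rw [bexp_insert l hi]
  simp only [chr_insert_insert hA]
  rw [bexp_congr (G := fun S => -b * (F S * chr a b A S))
      (fun S hS => by rw [chr_insert_left hA (fun h => hi (hS h))]; ring),
    bexp_congr (F := fun S => F (insert i S) * (a * chr a b A S))
      (G := fun S => a * (F (insert i S) * chr a b A S)) (fun S _ => by ring),
    bexp_const_mul, bexp_const_mul]
  ring

/-- The orthonormality relations of the two-point space `{0, 1}` with bias `l`. -/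
structure IsBias (l a b : ℝ) : Prop where
  pos : 0 < l
  lt_one : l < 1
  mean : l * a = (1 - l) * b
  mul : a * b = 1

theorem exists_isBias {l : ℝ} (h0 : 0 < l) (h1 : l < 1) : ∃ a b, IsBias l a b := by
  have h1' : 0 < 1 - l := by linarith
  refine ⟨√((1 - l) / l), √(l / (1 - l)), h0, h1, ?_, ?_⟩
  · have hl : l = √l * √l := (Real.mul_self_sqrt h0.le).symm
    have hl' : 1 - l = √(1 - l) * √(1 - l) := (Real.mul_self_sqrt h1'.le).symm
    rw [Real.sqrt_div h1'.le, Real.sqrt_div h0.le]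
    have := Real.sqrt_pos.2 h0
    have := Real.sqrt_pos.2 h1'
    field_simp
    rw [Real.sq_sqrt h0.le, Real.sq_sqrt h1'.le]; ring
  · rw [← Real.sqrt_mul (by positivity)]
    rw [show (1 - l) / l * (l / (1 - l)) = 1 by field_simp, Real.sqrt_one]

theorem IsBias.sq_left {l a b : ℝ} (h : IsBias l a b) : l * a ^ 2 = 1 - l := by
  linear_combination a * h.mean + (1 - l) * h.mul

theorem IsBias.sq_right {l a b : ℝ} (h : IsBias l a b) : (1 - l) * b ^ 2 = l := by
  linear_combination -b * h.mean + l * h.mul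

theorem sum_coef_mul_coef {l a b : ℝ} (h : IsBias l a b) (J : Finset ι) (F G : Finset ι → ℝ) :
    ∑ A ∈ J.powerset, coef l a b J F A * coef l a b J G A = bexp l J fun S => F S * G S := by
  induction J using Finset.induction_on generalizing F G with
  | empty => simp [coef, bexp_empty, chr]
  | insert i J hi ih =>
    rw [Finset.sum_powerset_insert hi, bexp_insert l hi, ← ih, ← ih, Finset.mul_sum,
      Finset.mul_sum, ← Finset.sum_add_distrib, ← Finset.sum_add_distrib]
    refine Finset.sum_congr rfl fun A hA => ?_
    have hA : i ∉ A := fun h => hi (Finset.mem_powerset.1 hA h)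
    rw [coef_insert_of_notMem hi hA, coef_insert_of_notMem hi hA, coef_insert_insert hi hA,
      coef_insert_insert hi hA]
    generalize coef l a b J F A = f0
    generalize coef l a b J G A = g0
    generalize coef l a b J (fun S => F (insert i S)) A = f1
    generalize coef l a b J (fun S => G (insert i S)) A = g1
    linear_combination (1 - l) * f0 * g0 * h.sq_right + l * f1 * g1 * h.sq_left
      - l * (1 - l) * (f0 * g1 + f1 * g0) * h.mul

theorem coef_eq_zero {l a b : ℝ} (h : IsBias l a b) {i : ι} {J A : Finset ι} (hJ : i ∈ J)
    (hA : i ∈ A) {F : Finset ι → ℝ} (hF : ∀ S, F (insert i S) = F S) :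
    coef l a b J F A = 0 := by
  rw [← Finset.insert_erase hJ, ← Finset.insert_erase hA,
    coef_insert_insert (Finset.notMem_erase i J) (Finset.notMem_erase i A)]
  simp only [hF]
  linear_combination coef l a b (J.erase i) F (A.erase i) * h.mean

/-- The noise operator applied to a function with coefficients `f`. -/
noncomputable def noise (a b r : ℝ) (J : Finset ι) (f : Finset ι → ℝ) (S : Finset ι) : ℝ :=
  ∑ A ∈ J.powerset, r ^ A.card * f A * chr a b A S

theorem noise_insert {a b r : ℝ} {i : ι} {J : Finset ι} (hi : i ∉ J) (f : Finset ι → ℝ)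
    {S : Finset ι} (hS : i ∉ S) :
    noise a b r (insert i J) f S
      = noise a b r J f S + r * -b * noise a b r J (fun A => f (insert i A)) S := by
  unfold noise
  rw [Finset.sum_powerset_insert hi, Finset.mul_sum]
  congr 1
  refine Finset.sum_congr rfl fun A hA => ?_
  have hA : i ∉ A := fun h => hi (Finset.mem_powerset.1 hA h)
  rw [chr_insert_left hA hS, Finset.card_insert_of_notMem hA]
  ring

theorem noise_insert_insert {a b r : ℝ} {i : ι} {J : Finset ι} (hi : i ∉ J) (f : Finset ι → ℝ)
    (S : Finset ι) :
    noise a b r (insert i J) f (insert i S)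
      = noise a b r J f S + r * a * noise a b r J (fun A => f (insert i A)) S := by
  unfold noise
  rw [Finset.sum_powerset_insert hi, Finset.mul_sum]
  congr 1
  · refine Finset.sum_congr rfl fun A hA => ?_
    have hA : i ∉ A := fun h => hi (Finset.mem_powerset.1 hA h)
    rw [chr_insert_right hA]
  · refine Finset.sum_congr rfl fun A hA => ?_
    have hA : i ∉ A := fun h => hi (Finset.mem_powerset.1 hA h)
    rw [chr_insert_insert hA, Finset.card_insert_of_notMem hA]
    ring

/-- The smallness condition on the noise rate that makes it `(2, 4)`-hypercontractive. -/
def IsSmallNoise (l a b r : ℝ) : Prop :=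
  6 * r ^ 2 + 2 * r ^ 3 * |l * a ^ 3 - (1 - l) * b ^ 3| ≤ 2 ∧
    r ^ 4 * (l * a ^ 4 + (1 - l) * b ^ 4) + 2 * r ^ 3 * |l * a ^ 3 - (1 - l) * b ^ 3| ≤ 1

theorem exists_isSmallNoise (l a b : ℝ) : ∃ k : ℕ, IsSmallNoise l a b ((1 / 2) ^ k) := by
  have ht : Filter.Tendsto (fun k : ℕ => (1 / 2 : ℝ) ^ k) Filter.atTop (nhds 0) :=
    tendsto_pow_atTop_nhds_zero_of_lt_one (by norm_num) (by norm_num)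
  set c := |l * a ^ 3 - (1 - l) * b ^ 3| with hc
  set e := l * a ^ 4 + (1 - l) * b ^ 4 with he
  have h1 : Filter.Tendsto (fun k : ℕ => 6 * ((1 / 2 : ℝ) ^ k) ^ 2 + 2 * ((1 / 2 : ℝ) ^ k) ^ 3 * c)
      Filter.atTop (nhds (6 * 0 ^ 2 + 2 * 0 ^ 3 * c)) :=
    ((ht.pow 2).const_mul 6).add (((ht.pow 3).const_mul 2).mul_const c)
  have h2 : Filter.Tendsto (fun k : ℕ => ((1 / 2 : ℝ) ^ k) ^ 4 * e + 2 * ((1 / 2 : ℝ) ^ k) ^ 3 * c)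
      Filter.atTop (nhds (0 ^ 4 * e + 2 * 0 ^ 3 * c)) :=
    ((ht.pow 4).mul_const e).add (((ht.pow 3).const_mul 2).mul_const c)
  have h1' := h1.eventually_lt_const (u := 2) (by norm_num)
  have h2' := h2.eventually_lt_const (u := 1) (by norm_num)
  obtain ⟨k, hk1, hk2⟩ := (h1'.and h2').exists
  exact ⟨k, hk1.le, hk2.le⟩

theorem two_point_fourth_moment {l a b r : ℝ} (h : IsBias l a b) (hr : 0 ≤ r)
    (hs : IsSmallNoise l a b r) (u v : ℝ) :
    (1 - l) * (u + r * -b * v) ^ 4 + l * (u + r * a * v) ^ 4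
      ≤ u ^ 4 + 2 * (u ^ 2 * v ^ 2) + v ^ 4 := by
  obtain ⟨h1, h2⟩ := hs
  set c := l * a ^ 3 - (1 - l) * b ^ 3 with hc
  set e := l * a ^ 4 + (1 - l) * b ^ 4 with he
  have expand : (1 - l) * (u + r * -b * v) ^ 4 + l * (u + r * a * v) ^ 4
      = u ^ 4 + 6 * r ^ 2 * (u ^ 2 * v ^ 2) + 4 * r ^ 3 * c * (u * v ^ 3) + r ^ 4 * e * v ^ 4 := by
    rw [hc, he]
    linear_combination 4 * u ^ 3 * v * r * h.mean
      + 6 * u ^ 2 * v ^ 2 * r ^ 2 * (h.sq_left + h.sq_right)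
  have h3 : c * (u * v ^ 3) ≤ |c| * ((u ^ 2 * v ^ 2 + v ^ 4) / 2) := by
    refine (le_abs_self _).trans ?_
    rw [abs_mul]
    refine mul_le_mul_of_nonneg_left ?_ (abs_nonneg _)
    rw [abs_le]
    constructor <;> nlinarith [sq_nonneg (v * (u - v)), sq_nonneg (v * (u + v))]
  have h4 : 0 ≤ r ^ 3 := by positivity
  have h5 : 0 ≤ u ^ 2 * v ^ 2 := by positivity
  have h6 : 0 ≤ v ^ 4 := by positivity
  rw [expand]
  nlinarith [mul_le_mul_of_nonneg_left h3 h4, mul_le_mul_of_nonneg_right h1 h5,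
    mul_le_mul_of_nonneg_right h2 h6]

/-- Biased Bonami inequality: the noise operator is a contraction from `L²` to `L⁴`. -/
theorem bexp_noise_pow_four_le {l a b r : ℝ} (h : IsBias l a b) (hr : 0 ≤ r)
    (hs : IsSmallNoise l a b r) (J : Finset ι) (f : Finset ι → ℝ) :
    bexp l J (fun S => noise a b r J f S ^ 4) ≤ (∑ A ∈ J.powerset, f A ^ 2) ^ 2 := by
  induction J using Finset.induction_on generalizing f with
  | empty => simp [bexp_empty, noise, chr, ← pow_mul]
  | insert i J hi ih =>
    set u := noise a b r J f with hu
    set v := noise a b r J (fun A => f (insert i A)) with hv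
    set X := ∑ A ∈ J.powerset, f A ^ 2 with hX
    set Y := ∑ A ∈ J.powerset, f (insert i A) ^ 2 with hY
    have hX0 : 0 ≤ X := Finset.sum_nonneg fun _ _ => sq_nonneg _
    have hY0 : 0 ≤ Y := Finset.sum_nonneg fun _ _ => sq_nonneg _
    have h0 := h.pos.le
    have h1 := h.lt_one.le
    have e1 : bexp l (insert i J) (fun S => noise a b r (insert i J) f S ^ 4)
        = bexp l J (fun S => (1 - l) * (u S + r * -b * v S) ^ 4
            + l * (u S + r * a * v S) ^ 4) := by
      rw [bexp_insert l hi, bexp_add, bexp_const_mul, bexp_const_mul]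
      congr 2
      · exact bexp_congr fun S hS => by rw [noise_insert hi f fun h => hi (hS h)]
      · exact bexp_congr fun S _ => by rw [noise_insert_insert hi f]
    have e2 : bexp l J (fun S => u S ^ 4 + 2 * (u S ^ 2 * v S ^ 2) + v S ^ 4)
        = bexp l J (fun S => u S ^ 4) + 2 * bexp l J (fun S => u S ^ 2 * v S ^ 2)
          + bexp l J (fun S => v S ^ 4) := by
      rw [bexp_add, bexp_add, bexp_const_mul]
    have hu4 : bexp l J (fun S => u S ^ 4) ≤ X ^ 2 := ih f
    have hv4 : bexp l J (fun S => v S ^ 4) ≤ Y ^ 2 := ih _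
    have huv : bexp l J (fun S => u S ^ 2 * v S ^ 2) ≤ X * Y := by
      refine abs_le_of_sq_le_sq' ?_ (by positivity) |>.2
      refine (bexp_mul_sq_le h0 h1 J _ _).trans ?_
      simp only [← pow_mul, Nat.reduceMul]
      rw [mul_pow]
      exact mul_le_mul hu4 hv4 (bexp_nonneg h0 h1 fun S => by positivity) (by positivity)
    rw [e1, Finset.sum_powerset_insert hi]
    refine (bexp_mono h0 h1 fun S _ => two_point_fourth_moment h hr hs (u S) (v S)).trans ?_
    rw [e2]
    nlinarith

/-- Small-set expansion for the noise operator. -/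
theorem noise_stability_pow_four_le {l a b r : ℝ} (h : IsBias l a b) (hr : 0 ≤ r)
    (hs : IsSmallNoise l a b r) (J : Finset ι) (g : Finset ι → ℝ) (hg : ∀ S, g S ^ 2 = g S) :
    (∑ A ∈ J.powerset, r ^ A.card * coef l a b J g A ^ 2) ^ 4 ≤ bexp l J g ^ 5 := by
  have h0 := h.pos.le
  have h1 := h.lt_one.le
  set T := noise a b r J (coef l a b J g) with hT
  have e : ∑ A ∈ J.powerset, r ^ A.card * coef l a b J g A ^ 2
      = bexp l J fun S => g S * (g S * T S) := by
    have : (fun S => g S * (g S * T S))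
        = fun S => ∑ A ∈ J.powerset, (r ^ A.card * coef l a b J g A) * (g S * chr a b A S) := by
      funext S
      rw [← mul_assoc, ← pow_two, hg, hT, noise, Finset.mul_sum]
      exact Finset.sum_congr rfl fun A _ => by ring
    rw [this, bexp_sum]
    refine Finset.sum_congr rfl fun A _ => ?_
    rw [bexp_const_mul, pow_two, ← mul_assoc]
    rfl
  have hb : 0 ≤ bexp l J g := bexp_nonneg h0 h1 fun S => by rw [← hg S]; positivity
  have h2 := bexp_mul_sq_le h0 h1 J g fun S => g S * T S
  have h3 := bexp_mul_sq_le h0 h1 J g fun S => T S ^ 2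
  simp only [mul_pow, hg, ← pow_mul, Nat.reduceMul] at h2 h3
  have h4 : bexp l J (fun S => T S ^ 4) ≤ bexp l J g ^ 2 := by
    refine (bexp_noise_pow_four_le h hr hs J _).trans (le_of_eq ?_)
    congr 1
    have := sum_coef_mul_coef h J g g
    simp only [← pow_two, hg] at this
    exact this
  rw [e]
  calc (bexp l J fun S => g S * (g S * T S)) ^ 4
      = ((bexp l J fun S => g S * (g S * T S)) ^ 2) ^ 2 := by ring
    _ ≤ (bexp l J g * bexp l J fun S => g S * T S ^ 2) ^ 2 := by gcongr
    _ = bexp l J g ^ 2 * (bexp l J fun S => g S * T S ^ 2) ^ 2 := by ring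
    _ ≤ bexp l J g ^ 2 * (bexp l J g * bexp l J g ^ 2) := by
        gcongr
        exact h3.trans (mul_le_mul_of_nonneg_left h4 hb)
    _ = bexp l J g ^ 5 := by ring

end Fourier
theorem zmod_two_eq_one {a : ZMod 2} (h : a ≠ 0) : a = 1 := by
  revert a; decide

section Codes

variable {ι : Type*} [Fintype ι] [DecidableEq ι] (C : Submodule (ZMod 2) (ι → ZMod 2))

/-- The codewords of `C` supported in `S`. -/
noncomputable def shortened (S : Finset ι) : Finset (ι → ZMod 2) :=
  {c | c ∈ C ∧ ∀ i ∉ S, c i = 0}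

theorem mem_shortened {S : Finset ι} {c : ι → ZMod 2} :
    c ∈ shortened C S ↔ c ∈ C ∧ ∀ i ∉ S, c i = 0 := by
  simp [shortened]

/-- The coordinate `i` cannot be recovered when the coordinates in `S` (and `i` itself) are
erased. -/
def Fails (i : ι) (S : Finset ι) : Prop :=
  ∃ c ∈ C, c i ≠ 0 ∧ ∀ j ∉ S, j ≠ i → c j = 0

variable {C}

set_option linter.unusedSectionVars false

theorem Fails.mono {i : ι} {S T : Finset ι} (h : S ⊆ T) : Fails C i S → Fails C i T :=
  fun ⟨c, hc, hi, hS⟩ => ⟨c, hc, hi, fun j hj => hS j fun hjS => hj (h hjS)⟩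

theorem fails_insert_self {i : ι} {S : Finset ι} : Fails C i (insert i S) ↔ Fails C i S := by
  refine ⟨fun ⟨c, hc, hi, hS⟩ => ⟨c, hc, hi, fun j hj hji => hS j ?_ hji⟩,
    Fails.mono (Finset.subset_insert i S)⟩
  simp [hji, hj]

theorem shortened_subset_insert {i : ι} {S : Finset ι} :
    shortened C S ⊆ shortened C (insert i S) := fun c hc => by
  rw [mem_shortened] at hc ⊢
  exact ⟨hc.1, fun j hj => hc.2 j fun h => hj (Finset.mem_insert_of_mem h)⟩

theorem card_shortened_insert_of_not_fails {i : ι} {S : Finset ι} (h : ¬ Fails C i S) :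
    (shortened C (insert i S)).card = (shortened C S).card := by
  refine le_antisymm (Finset.card_le_card fun c hc => ?_)
    (Finset.card_le_card shortened_subset_insert)
  rw [mem_shortened] at hc ⊢
  refine ⟨hc.1, fun j hj => ?_⟩
  by_cases hji : j = i
  · subst hji
    by_contra hcj
    exact h ⟨c, hc.1, hcj, fun k hk hkj => hc.2 k (by simp [hk, hkj])⟩
  · exact hc.2 j (by simp [hj, hji])

theorem card_shortened_insert_of_fails {i : ι} {S : Finset ι} (hi : i ∉ S) (h : Fails C i S) :
    (shortened C (insert i S)).card = 2 * (shortened C S).card := by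
  obtain ⟨c0, hc0, hci, hcS⟩ := h
  have e : shortened C (insert i S)
      = shortened C S ∪ (shortened C S).map (Equiv.addRight c0).toEmbedding := by
    ext c
    simp only [Finset.mem_union, Finset.mem_map_equiv, mem_shortened]
    constructor
    · rintro ⟨hc, hS⟩
      by_cases hc0i : c i = 0
      · left
        refine ⟨hc, fun j hj => ?_⟩
        by_cases hji : j = i
        · rwa [hji]
        · exact hS j (by simp [hj, hji])
      · right
        refine ⟨by simpa [sub_eq_add_neg] using C.sub_mem hc hc0, fun j hj => ?_⟩
        by_cases hji : j = i
        · subst hji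
          simp [zmod_two_eq_one hc0i, zmod_two_eq_one hci, CharTwo.add_self_eq_zero]
        · simp [hS j (by simp [hj, hji]), hcS j hj hji]
    · rintro (⟨hc, hS⟩ | ⟨hc, hS⟩)
      · exact ⟨hc, fun j hj => hS j fun h => hj (Finset.mem_insert_of_mem h)⟩
      · have : c = (Equiv.addRight c0).symm c + c0 := by simp
        refine ⟨by rw [this]; exact C.add_mem hc hc0, fun j hj => ?_⟩
        rw [Finset.mem_insert, not_or] at hj
        rw [this, Pi.add_apply, hS j hj.2, hcS j hj.2 hj.1, add_zero]
  rw [e, Finset.card_union_of_disjoint, Finset.card_map, two_mul]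
  rw [Finset.disjoint_left]
  intro c hc hc'
  rw [Finset.mem_map_equiv, mem_shortened] at hc'
  rw [mem_shortened] at hc
  have h1 := hc.2 i hi
  have h2 := hc'.2 i hi
  simp [h1] at h2
  exact hci h2

theorem card_shortened_pos (S : Finset ι) : 0 < (shortened C S).card :=
  Finset.card_pos.2 ⟨0, (mem_shortened C).2 ⟨C.zero_mem, fun _ _ => rfl⟩⟩

theorem card_shortened_le (S : Finset ι) :
    (shortened C S).card ≤ 2 ^ (S.filter fun i => Fails C i S).card := by
  induction S using Finset.induction_on with
  | empty =>
    have : shortened C ∅ ⊆ {0} := fun c hc => by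
      rw [mem_shortened] at hc
      exact Finset.mem_singleton.2 (funext fun i => hc.2 i (Finset.notMem_empty i))
    simpa using Finset.card_le_card this
  | insert i S hi ih =>
    have hmono : (S.filter fun j => Fails C j S) ⊆ S.filter fun j => Fails C j (insert i S) :=
      Finset.monotone_filter_right S fun j _ => Fails.mono (Finset.subset_insert i S)
    by_cases h : Fails C i S
    · rw [card_shortened_insert_of_fails hi h, Finset.filter_insert,
        if_pos (fails_insert_self.2 h), Finset.card_insert_of_notMem (by simp [hi]), pow_succ,
        mul_comm]
      exact Nat.mul_le_mul_right 2
        (ih.trans (Nat.pow_le_pow_right two_pos (Finset.card_le_card hmono)))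
    · rw [card_shortened_insert_of_not_fails h, Finset.filter_insert,
        if_neg (fun h' => h (fails_insert_self.1 h'))]
      exact ih.trans (Nat.pow_le_pow_right two_pos (Finset.card_le_card hmono))

theorem card_shortened_mul_le (S T : Finset ι) (hST : Disjoint S T) :
    (shortened C S).card * 2 ^ (T.filter fun i => Fails C i S).card
      ≤ (shortened C (S ∪ T)).card := by
  induction T using Finset.induction_on with
  | empty => simp
  | insert i T hi ih =>
    rw [Finset.disjoint_insert_right] at hST
    have ih := ih hST.2
    have hiST : i ∉ S ∪ T := by simp [hi, hST.1]
    rw [Finset.union_insert, Finset.filter_insert]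
    by_cases h : Fails C i S
    · rw [if_pos h, Finset.card_insert_of_notMem (by simp [hi]), pow_succ,
        card_shortened_insert_of_fails hiST (h.mono Finset.subset_union_left)]
      linarith
    · rw [if_neg h]
      exact ih.trans (Finset.card_le_card shortened_subset_insert)

/-- Probability that coordinate `i` is not determined by the other coordinates when each of
them is erased with probability `l`. -/
noncomputable def failProb (C : Submodule (ZMod 2) (ι → ZMod 2)) (l : ℝ) (i : ι) : ℝ :=
  bexp l Finset.univ fun S => if Fails C i S then 1 else 0

theorem failProb_nonneg {l : ℝ} (h0 : 0 ≤ l) (h1 : l ≤ 1) (i : ι) : 0 ≤ failProb C l i :=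
  bexp_nonneg h0 h1 fun S => by split_ifs <;> norm_num

theorem bexp_mem_fails (l : ℝ) (i : ι) :
    bexp l Finset.univ (fun S => if i ∈ S ∧ Fails C i S then 1 else 0) = l * failProb C l i := by
  unfold failProb
  rw [← Finset.insert_erase (Finset.mem_univ i), bexp_insert l (Finset.notMem_erase i _),
    bexp_insert l (Finset.notMem_erase i _)]
  simp only [fails_insert_self, Finset.mem_insert_self, true_and]
  have : bexp l (Finset.univ.erase i) (fun S => if i ∈ S ∧ Fails C i S then 1 else 0) = 0 := by
    refine (bexp_congr fun S hS => ?_).trans (bexp_const l (Finset.univ.erase i) 0)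
    have : i ∉ S := fun h => Finset.notMem_erase i _ (hS h)
    simp [this]
  rw [this]; ring

theorem bexp_notMem_fails (l : ℝ) (i : ι) :
    bexp l Finset.univ (fun S => if i ∉ S ∧ Fails C i S then 1 else 0)
      = (1 - l) * failProb C l i := by
  have h := bexp_mem_fails (C := C) l i
  have : failProb C l i = bexp l Finset.univ (fun S => if i ∈ S ∧ Fails C i S then 1 else 0)
      + bexp l Finset.univ (fun S => if i ∉ S ∧ Fails C i S then 1 else 0) := by
    rw [← bexp_add]
    refine bexp_congr fun S _ => ?_
    by_cases h1 : i ∈ S <;> by_cases h2 : Fails C i S <;> simp [h1, h2]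
  linarith

/-- Upper bound on the average dimension of shortened codes. -/
theorem bexp_logb_card_shortened_le {l : ℝ} (h0 : 0 ≤ l) (h1 : l ≤ 1) :
    bexp l Finset.univ (fun S => Real.logb 2 (shortened C S).card)
      ≤ l * ∑ i, failProb C l i := by
  rw [Finset.mul_sum]
  simp only [← bexp_mem_fails]
  rw [← bexp_sum]
  refine bexp_mono h0 h1 fun S _ => ?_
  have h := card_shortened_le (C := C) S
  have hp := card_shortened_pos (C := C) S
  rw [Finset.sum_boole, Real.logb_le_iff_le_rpow one_lt_two (by exact_mod_cast hp),
    Real.rpow_natCast]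
  refine (Nat.cast_le.2 h).trans (le_of_eq ?_)
  have e : (Finset.univ.filter fun i => i ∈ S ∧ Fails C i S) = S.filter fun i => Fails C i S := by
    ext; simp
  rw [e]
  norm_num

/-- The area theorem, as an inequality. -/
theorem mul_sum_failProb_le {l : ℝ} (h0 : 0 ≤ l) (h1 : l ≤ 1) :
    (1 - l) * ∑ i, failProb C l i ≤ Real.logb 2 (shortened C Finset.univ).card := by
  rw [Finset.mul_sum]
  simp only [← bexp_notMem_fails]
  rw [← bexp_sum, ← bexp_const l (Finset.univ : Finset ι) (Real.logb 2 _)]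
  refine bexp_mono h0 h1 fun S _ => ?_
  have h := card_shortened_mul_le (C := C) S Sᶜ disjoint_compl_right
  have hp := card_shortened_pos (C := C) S
  rw [Finset.union_compl] at h
  rw [Finset.sum_boole, Real.le_logb_iff_rpow_le one_lt_two
    (Nat.cast_pos.2 (card_shortened_pos _)), Real.rpow_natCast]
  have e : (Finset.univ.filter fun i => i ∉ S ∧ Fails C i S) = Sᶜ.filter fun i => Fails C i S := by
    ext; simp
  rw [e]
  exact_mod_cast (Nat.le_mul_of_pos_left _ hp).trans h

variable (C) in
/-- Multivariate weight enumerator. -/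
noncomputable def enumerator (t : ι → ℝ) : ℝ :=
  ∑ c ∈ shortened C Finset.univ, ∏ i, if c i = 0 then 1 else t i

theorem mem_shortened_univ {c : ι → ZMod 2} : c ∈ shortened C Finset.univ ↔ c ∈ C := by
  simp [mem_shortened]

theorem enumerator_update (t : ι → ℝ) (i : ι) :
    ∃ A B : ℝ, (∀ s, enumerator C (Function.update t i s) = A + s * B) ∧
      ((∀ j, 0 ≤ t j) → 0 < A ∧ 0 ≤ B) := by
  set f : (ι → ZMod 2) → ℝ := fun c => ∏ j ∈ Finset.univ.erase i, if c j = 0 then 1 else t j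
    with hf
  refine ⟨∑ c ∈ shortened C Finset.univ with c i = 0, f c,
    ∑ c ∈ shortened C Finset.univ with ¬ c i = 0, f c, fun s => ?_, fun ht => ?_⟩
  · rw [enumerator, ← Finset.sum_filter_add_sum_filter_not _ (fun c => c i = 0), Finset.mul_sum]
    have key : ∀ c : ι → ZMod 2, (∏ j, if c j = 0 then 1 else Function.update t i s j)
        = (if c i = 0 then 1 else s) * f c := fun c => by
      rw [← Finset.mul_prod_erase _ _ (Finset.mem_univ i), Function.update_self]
      congr 1
      refine Finset.prod_congr rfl fun j hj => ?_
      rw [Function.update_of_ne (Finset.ne_of_mem_erase hj)]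
    congr 1
    · refine Finset.sum_congr rfl fun c hc => ?_
      rw [key, if_pos (Finset.mem_filter.1 hc).2, one_mul]
    · refine Finset.sum_congr rfl fun c hc => ?_
      rw [key, if_neg (Finset.mem_filter.1 hc).2]
  · have hf0 : ∀ c, 0 ≤ f c := fun c =>
      Finset.prod_nonneg fun j _ => by split_ifs; exacts [zero_le_one, ht j]
    refine ⟨Finset.sum_pos' (fun c _ => hf0 c) ⟨0, ?_, by simp [hf]⟩,
      Finset.sum_nonneg fun c _ => hf0 c⟩
    simp [mem_shortened_univ, C.zero_mem]

theorem enumerator_nonneg_of_sign {t : ι → ℝ} (ht : ∀ i, t i = 1 ∨ t i = -1) :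
    0 ≤ enumerator C t := by
  set F : (ι → ZMod 2) → ℝ := fun c => ∏ i, if c i = 0 then 1 else t i with hF
  have hmul : ∀ c c', F (c + c') = F c * F c' := fun c c' => by
    rw [hF, ← Finset.prod_mul_distrib]
    refine Finset.prod_congr rfl fun i _ => ?_
    have hsq : t i * t i = 1 := by rcases ht i with h | h <;> rw [h] <;> norm_num
    rw [Pi.add_apply]
    by_cases h1 : c i = 0 <;> by_cases h2 : c' i = 0
    · simp [h1, h2]
    · simp [h1, h2]
    · simp [h1, h2]
    · have : (1 : ZMod 2) + 1 = 0 := by decide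
      simp [zmod_two_eq_one h1, zmod_two_eq_one h2, this, hsq]
  by_cases h : ∀ c ∈ C, F c = 1
  · refine Finset.sum_nonneg fun c hc => ?_
    change 0 ≤ F c
    rw [h c (mem_shortened_univ.1 hc)]
    exact zero_le_one
  · push Not at h
    obtain ⟨c0, hc0, hne⟩ := h
    have e : enumerator C t = F c0 * enumerator C t := by
      rw [enumerator, Finset.mul_sum]
      refine Finset.sum_equiv (Equiv.addRight c0) (fun c => ?_) fun c _ => ?_
      · rw [mem_shortened_univ, mem_shortened_univ]
        exact (C.add_mem_iff_left hc0).symm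
      · change F c = F c0 * F (c + c0)
        have hsq : F c0 * F c0 = 1 := by
          rw [← hmul]
          have : c0 + c0 = 0 := funext fun i => CharTwo.add_self_eq_zero _
          simp [this, hF]
        rw [hmul]
        linear_combination -F c * hsq
    have : (F c0 - 1) * enumerator C t = 0 := by linear_combination -e
    rcases mul_eq_zero.1 this with h | h
    · exact absurd (sub_eq_zero.1 h) hne
    · exact h.ge

theorem enumerator_nonneg_of_abs_le (J : Finset ι) {t : ι → ℝ} (hJ : ∀ i ∈ J, |t i| ≤ 1)
    (ht : ∀ i ∉ J, t i = 1 ∨ t i = -1) : 0 ≤ enumerator C t := by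
  induction J using Finset.induction_on generalizing t with
  | empty => exact enumerator_nonneg_of_sign fun i => ht i (Finset.notMem_empty i)
  | insert i J hi ih =>
    obtain ⟨A, B, hAB, -⟩ := enumerator_update (C := C) t i
    have key : ∀ s : ℝ, s = 1 ∨ s = -1 → 0 ≤ enumerator C (Function.update t i s) := fun s hs => by
      refine ih (fun j hj => ?_) fun j hj => ?_
      · rw [Function.update_of_ne fun h => hi (by rwa [h] at hj)]
        exact hJ j (Finset.mem_insert_of_mem hj)
      · by_cases hji : j = i
        · subst hji; simpa using hs
        · rw [Function.update_of_ne hji]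
          exact ht j (by simp [hji, hj])
    have h1 := key 1 (Or.inl rfl)
    have h2 := key (-1) (Or.inr rfl)
    have h3 := abs_le.1 (hJ i (Finset.mem_insert_self i J))
    rw [hAB] at h1 h2
    rw [← Function.update_eq_self i t, hAB]
    nlinarith

theorem logb_add_mul_le {A B s : ℝ} (hA : 0 < A) (hB : 0 ≤ B) (hBA : B ≤ A) (hs0 : 0 ≤ s)
    (hs1 : s ≤ 1) :
    Real.logb 2 (A + s * B) ≤ (1 - Real.logb 2 (1 + s)) * Real.logb 2 A
      + Real.logb 2 (1 + s) * Real.logb 2 (A + B) := by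
  set l := Real.logb 2 (1 + s) with hl
  have hl0 : 0 ≤ l := Real.logb_nonneg one_lt_two (by linarith)
  have hl1 : l ≤ 1 := by
    rw [hl, Real.logb_le_iff_le_rpow one_lt_two (by linarith), Real.rpow_one]; linarith
  have h2l : (2 : ℝ) ^ l = 1 + s := Real.rpow_logb two_pos (by norm_num) (by linarith)
  set y := B / A with hy
  have hy0 : 0 ≤ y := by positivity
  have hy1 : y ≤ 1 := (div_le_one hA).2 hBA
  have hBy : B = A * y := by rw [hy]; field_simp
  have hc := (Real.concaveOn_rpow hl0 hl1).2 (x := 1) (y := 2) (by simp) (by simp)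
    (sub_nonneg.2 hy1) hy0 (by ring)
  simp only [smul_eq_mul, Real.one_rpow, h2l] at hc
  have hc' : 1 + s * y ≤ (1 + y) ^ l := by
    rw [show 1 + y = (1 - y) * 1 + y * 2 by ring]
    linarith
  have h1 : A + s * B = A * (1 + s * y) := by rw [hBy]; ring
  have h2 : A + B = A * (1 + y) := by rw [hBy]; ring
  have hsy : 0 < 1 + s * y := by positivity
  rw [h1, h2, Real.logb_mul hA.ne' hsy.ne', Real.logb_mul hA.ne' (by positivity)]
  have h3 : Real.logb 2 (1 + s * y) ≤ l * Real.logb 2 (1 + y) := by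
    rw [← Real.logb_rpow_eq_mul_logb_of_pos (by positivity)]
    exact Real.logb_le_logb_of_le one_lt_two hsy hc'
  linarith

theorem logb_enumerator_update_le {t : ι → ℝ} (h0 : ∀ i, 0 ≤ t i) (h1 : ∀ i, t i ≤ 1) (i : ι)
    {s : ℝ} (hs0 : 0 ≤ s) (hs1 : s ≤ 1) :
    Real.logb 2 (enumerator C (Function.update t i s))
      ≤ (1 - Real.logb 2 (1 + s)) * Real.logb 2 (enumerator C (Function.update t i 0))
        + Real.logb 2 (1 + s) * Real.logb 2 (enumerator C (Function.update t i 1)) := by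
  obtain ⟨A, B, hAB, hpos⟩ := enumerator_update (C := C) t i
  obtain ⟨hA, hB⟩ := hpos h0
  have hBA : 0 ≤ enumerator C (Function.update t i (-1)) := by
    refine enumerator_nonneg_of_abs_le (Finset.univ.erase i) (fun j hj => ?_) fun j hj => ?_
    · rw [Function.update_of_ne (Finset.ne_of_mem_erase hj), abs_of_nonneg (h0 j)]
      exact h1 j
    · have : j = i := by simpa using hj
      subst this
      simp
  rw [hAB] at hBA
  rw [hAB, hAB, hAB, zero_mul, add_zero, one_mul]
  exact logb_add_mul_le hA hB (by linarith) hs0 hs1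

theorem logb_enumerator_le_bexp {s : ℝ} (hs0 : 0 ≤ s) (hs1 : s ≤ 1) (J S : Finset ι)
    (hJS : Disjoint J S) :
    Real.logb 2 (enumerator C fun i => if i ∈ J then s else if i ∈ S then 1 else 0)
      ≤ bexp (Real.logb 2 (1 + s)) J fun T =>
        Real.logb 2 (enumerator C fun i => if i ∈ S ∪ T then 1 else 0) := by
  set l := Real.logb 2 (1 + s) with hl
  have hl0 : 0 ≤ l := Real.logb_nonneg one_lt_two (by linarith)
  have hl1 : l ≤ 1 := by
    rw [hl, Real.logb_le_iff_le_rpow one_lt_two (by linarith), Real.rpow_one]; linarith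
  induction J using Finset.induction_on generalizing S with
  | empty => simp [bexp_empty]
  | insert i J hi ih =>
    rw [Finset.disjoint_insert_left] at hJS
    have hd : Disjoint J (insert i S) := by
      rw [Finset.disjoint_insert_right]; exact ⟨hi, hJS.2⟩
    set t : ι → ℝ := fun i => if i ∈ J then s else if i ∈ S then 1 else 0 with ht
    have h := logb_enumerator_update_le (C := C) (t := t)
      (fun j => by simp only [ht]; split_ifs <;> linarith)
      (fun j => by simp only [ht]; split_ifs <;> linarith) i hs0 hs1
    have e1 : Function.update t i s
        = fun j => if j ∈ insert i J then s else if j ∈ S then 1 else 0 := by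
      funext j
      by_cases hj : j = i
      · subst hj; simp
      · simp [ht, hj]
    have e2 : Function.update t i 0 = t := by
      rw [Function.update_eq_self_iff]
      simp [ht, hi, hJS.1]
    have e3 : Function.update t i 1
        = fun j => if j ∈ J then s else if j ∈ insert i S then 1 else 0 := by
      funext j
      by_cases hj : j = i
      · subst hj; simp [hi]
      · simp [ht, hj]
    rw [e1, e2, e3, ← hl] at h
    rw [bexp_insert l hi]
    refine h.trans (add_le_add (mul_le_mul_of_nonneg_left (ih S hJS.2) (by linarith))
      (mul_le_mul_of_nonneg_left ((ih _ hd).trans (le_of_eq ?_)) hl0))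
    simp only [Finset.insert_union, Finset.union_insert]

theorem enumerator_indicator (S : Finset ι) :
    enumerator C (fun i => if i ∈ S then 1 else 0) = (shortened C S).card := by
  have e : shortened C S = (shortened C Finset.univ).filter fun c => ∀ i ∉ S, c i = 0 := by
    ext c; simp [mem_shortened]
  rw [e, ← Finset.sum_boole]
  refine Finset.sum_congr rfl fun c _ => ?_
  split_ifs with h
  · refine Finset.prod_eq_one fun i _ => ?_
    by_cases hi : i ∈ S
    · simp [hi]
    · simp [h i hi]
  · push Not at h
    obtain ⟨i, hi, hci⟩ := h
    exact Finset.prod_eq_zero (Finset.mem_univ i) (by simp [hi, hci])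

/-- Samorodnitsky's inequality: the weight enumerator at `s` is controlled by the erasure channel
with erasure probability `logb 2 (1 + s)`. -/
theorem logb_sum_pow_weight_le {s : ℝ} (hs0 : 0 ≤ s) (hs1 : s ≤ 1) :
    Real.logb 2 (∑ c ∈ shortened C Finset.univ, s ^ (Finset.univ.filter fun i => c i ≠ 0).card)
      ≤ Real.logb 2 (1 + s) * ∑ i, failProb C (Real.logb 2 (1 + s)) i := by
  have hl0 : 0 ≤ Real.logb 2 (1 + s) := Real.logb_nonneg one_lt_two (by linarith)
  have hl1 : Real.logb 2 (1 + s) ≤ 1 := by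
    rw [Real.logb_le_iff_le_rpow one_lt_two (by linarith), Real.rpow_one]; linarith
  have h := logb_enumerator_le_bexp (C := C) hs0 hs1 Finset.univ ∅ (Finset.disjoint_empty_right _)
  simp only [Finset.mem_univ, if_true, Finset.empty_union, enumerator_indicator] at h
  refine le_trans (le_of_eq ?_) (h.trans (bexp_logb_card_shortened_le hl0 hl1))
  congr 1
  refine Finset.sum_congr rfl fun c _ => ?_
  rw [← Finset.prod_filter_mul_prod_filter_not Finset.univ fun i => c i = 0]
  rw [Finset.prod_eq_one (s := Finset.univ.filter fun i => c i = 0)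
    (fun i hi => by simp [(Finset.mem_filter.1 hi).2])]
  rw [one_mul, Finset.prod_congr rfl (g := fun _ => s)
    (fun i hi => by simp [(Finset.mem_filter.1 hi).2]), Finset.prod_const]

end Codes
section ReedMuller

/-- The Reed-Muller code as a linear subspace. -/
def RM (m d : ℕ) : Submodule (ZMod 2) ((Fin m → ZMod 2) → ZMod 2) where
  carrier := RMcode m d
  add_mem' := by
    rintro _ _ ⟨f, hf, rfl⟩ ⟨g, hg, rfl⟩
    exact ⟨f + g, (MvPolynomial.totalDegree_add f g).trans (max_le hf hg), by ext; simp⟩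
  zero_mem' := ⟨0, by simp, by ext; simp⟩
  smul_mem' := by
    rintro a _ ⟨f, hf, rfl⟩
    exact ⟨a • f, (MvPolynomial.totalDegree_smul_le a f).trans hf, by ext; simp⟩

theorem mem_RM {m d : ℕ} {c : (Fin m → ZMod 2) → ZMod 2} : c ∈ RM m d ↔ c ∈ RMcode m d := Iff.rfl

theorem mul_mem_RM {m a b : ℕ} {f g : (Fin m → ZMod 2) → ZMod 2} (hf : f ∈ RM m a)
    (hg : g ∈ RM m b) : f * g ∈ RM m (a + b) := by
  obtain ⟨p, hp, rfl⟩ := hf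
  obtain ⟨q, hq, rfl⟩ := hg
  exact ⟨p * q, (MvPolynomial.totalDegree_mul p q).trans (add_le_add hp hq), by ext; simp⟩

theorem RM_mono {m a b : ℕ} (h : a ≤ b) : RM m a ≤ RM m b := fun _ ⟨f, hf, hc⟩ => ⟨f, hf.trans h, hc⟩

theorem one_mem_RM (m d : ℕ) : (1 : (Fin m → ZMod 2) → ZMod 2) ∈ RM m d := ⟨1, by simp, by ext; simp⟩

theorem prod_mem_RM {α : Type*} {m : ℕ} (I : Finset α) (f : α → (Fin m → ZMod 2) → ZMod 2)
    (hf : ∀ i ∈ I, f i ∈ RM m 1) : ∏ i ∈ I, f i ∈ RM m I.card := by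
  induction I using Finset.induction_on with
  | empty => simpa using one_mem_RM m 0
  | insert i I hi ih =>
    rw [Finset.prod_insert hi, Finset.card_insert_of_notMem hi, add_comm]
    exact mul_mem_RM (hf i (Finset.mem_insert_self i I))
      (ih fun j hj => hf j (Finset.mem_insert_of_mem hj))

/-- The multilinear monomial with variable set `I`. -/
def mono {m : ℕ} (I : Finset (Fin m)) (x : Fin m → ZMod 2) : ZMod 2 := ∏ i ∈ I, x i

/-- The sets of at most `d` variables. -/
def lowSets (m d : ℕ) : Finset (Finset (Fin m)) := {I | I.card ≤ d}

theorem mem_lowSets {m d : ℕ} {I : Finset (Fin m)} : I ∈ lowSets m d ↔ I.card ≤ d := by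
  simp [lowSets]

/-- The volume of the Hamming ball of radius `k` in dimension `n`. -/
def vol (n k : ℕ) : ℕ := ∑ i ∈ Finset.range (k + 1), n.choose i

theorem card_lowSets (m d : ℕ) : (lowSets m d).card = vol m d := by
  have e : lowSets m d = (Finset.range (d + 1)).biUnion
      fun i => Finset.powersetCard i (Finset.univ : Finset (Fin m)) := by
    ext I
    simp [mem_lowSets, Finset.mem_powersetCard]
  rw [e, Finset.card_biUnion]
  · simp [vol, Finset.card_powersetCard]
  · intro i _ j _ hij
    exact Finset.pairwise_disjoint_powersetCard _ hij

theorem RM_le_span (m d : ℕ) :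
    RM m d ≤ Submodule.span (ZMod 2) ((lowSets m d).image mono : Finset _) := by
  rintro _ ⟨f, hf, rfl⟩
  have hpow : ∀ (a : ZMod 2) (k : ℕ), k ≠ 0 → a ^ k = a := fun a k hk => by
    by_cases ha : a = 0
    · simp [ha, hk]
    · simp [zmod_two_eq_one ha]
  have e : (fun x => MvPolynomial.eval x f)
      = ∑ s ∈ f.support, MvPolynomial.coeff s f • (mono s.support : (Fin m → ZMod 2) → ZMod 2) := by
    funext x
    rw [MvPolynomial.eval_eq, Finset.sum_apply]
    refine Finset.sum_congr rfl fun s _ => ?_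
    rw [Pi.smul_apply, smul_eq_mul, mono]
    congr 1
    exact Finset.prod_congr rfl fun i hi => hpow _ _ (Finsupp.mem_support_iff.1 hi)
  rw [e]
  refine Submodule.sum_mem _ fun s hs => Submodule.smul_mem _ _ (Submodule.subset_span ?_)
  refine Finset.mem_coe.2 (Finset.mem_image_of_mem _ (mem_lowSets.2 ?_))
  refine le_trans ?_ ((MvPolynomial.le_totalDegree hs).trans hf)
  rw [Finset.card_eq_sum_ones]
  exact Finset.sum_le_sum fun i hi => Nat.one_le_iff_ne_zero.2 (Finsupp.mem_support_iff.1 hi)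

theorem card_span_le {ι : Type*} [Fintype ι] (s : Finset (ι → ZMod 2)) :
    (Finset.univ.filter fun c => c ∈ Submodule.span (ZMod 2) (s : Set (ι → ZMod 2))).card
      ≤ 2 ^ s.card := by
  have h := Module.card_eq_pow_finrank (K := ZMod 2)
    (V := Submodule.span (ZMod 2) (s : Set (ι → ZMod 2)))
  rw [ZMod.card] at h
  rw [← Fintype.card_subtype]
  refine le_of_eq_of_le ?_ (Nat.pow_le_pow_right two_pos (finrank_span_finset_le_card (R := ZMod 2) s))
  exact h

theorem card_RM_le (m d : ℕ) : (shortened (RM m d) Finset.univ).card ≤ 2 ^ vol m d := by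
  have h := card_span_le ((lowSets m d).image (mono (m := m)))
  refine (Finset.card_le_card fun c hc => ?_).trans
    (h.trans (Nat.pow_le_pow_right two_pos (Finset.card_image_le.trans (card_lowSets m d).le)))
  rw [mem_shortened_univ] at hc
  simpa using RM_le_span m d hc

theorem coord_mem_RM {m : ℕ} (i : Fin m) : (fun x : Fin m → ZMod 2 => x i) ∈ RM m 1 :=
  ⟨MvPolynomial.X i, by simp, by ext; simp⟩

theorem comp_mem_RM {m n d : ℕ} {c : (Fin m → ZMod 2) → ZMod 2} (hc : c ∈ RM m d)
    (A : (Fin n → ZMod 2) → (Fin m → ZMod 2)) (hA : ∀ i, (fun x => A x i) ∈ RM n 1) :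
    (fun x => c (A x)) ∈ RM n d := by
  refine Submodule.span_induction (p := fun c _ => (fun x => c (A x)) ∈ RM n d) ?_ ?_ ?_ ?_
    (RM_le_span m d hc)
  · intro c hc
    obtain ⟨I, hI, rfl⟩ := Finset.mem_image.1 (Finset.mem_coe.1 hc)
    have h := prod_mem_RM I (fun i x => A x i) fun i _ => hA i
    convert RM_mono (mem_lowSets.1 hI) h using 1
    funext x
    simp [mono]
  · exact (RM n d).zero_mem
  · exact fun f g _ _ hf hg => (RM n d).add_mem hf hg
  · exact fun a f _ hf => (RM n d).smul_mem a hf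

theorem linear_mem_RM {n : ℕ} (φ : (Fin n → ZMod 2) →ₗ[ZMod 2] ZMod 2) :
    (fun x => φ x) ∈ RM n 1 := by
  have e : (fun x => φ x) = ∑ i, φ (fun j => if i = j then 1 else 0) •
      (fun x : Fin n → ZMod 2 => x i) := by
    funext x
    rw [LinearMap.pi_apply_eq_sum_univ φ x, Finset.sum_apply]
    exact Finset.sum_congr rfl fun i _ => by simp [mul_comm]
  rw [e]
  exact Submodule.sum_mem _ fun i _ => Submodule.smul_mem _ _ (coord_mem_RM i)

theorem comp_affine_mem_RM {m n d : ℕ} {c : (Fin m → ZMod 2) → ZMod 2} (hc : c ∈ RM m d)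
    (L : (Fin n → ZMod 2) →ₗ[ZMod 2] (Fin m → ZMod 2)) (v : Fin m → ZMod 2) :
    (fun x => c (L x + v)) ∈ RM n d := by
  refine comp_mem_RM hc (fun x => L x + v) fun i => ?_
  refine (RM n 1).add_mem (linear_mem_RM ((LinearMap.proj i).comp L)) ?_
  convert (RM n 1).smul_mem (v i) (one_mem_RM n 1) using 1
  funext x; simp

theorem comp_linear_mem_RM {m n d : ℕ} {c : (Fin m → ZMod 2) → ZMod 2} (hc : c ∈ RM m d)
    (L : (Fin n → ZMod 2) →ₗ[ZMod 2] (Fin m → ZMod 2)) : (fun x => c (L x)) ∈ RM n d := by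
  simpa using comp_affine_mem_RM hc L 0

theorem comp_translate_mem_RM {m d : ℕ} {c : (Fin m → ZMod 2) → ZMod 2} (hc : c ∈ RM m d)
    (v : Fin m → ZMod 2) : (fun x => c (x + v)) ∈ RM m d :=
  comp_affine_mem_RM hc LinearMap.id v

/-- The erasure failure probability of a coordinate of `RM(m, d)`. -/
noncomputable def rmFail (l : ℝ) (m d : ℕ) : ℝ := failProb (RM m d) l 0

theorem failProb_RM (l : ℝ) (m d : ℕ) (x : Fin m → ZMod 2) :
    failProb (RM m d) l x = rmFail l m d := by
  refine Eq.trans ?_ (bexp_map_equiv l (Equiv.addRight x)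
    fun S => if Fails (RM m d) 0 S then 1 else 0)
  refine bexp_congr fun S _ => ?_
  congr 1
  refine propext ⟨fun ⟨c, hc, hx, hS⟩ => ⟨_, comp_translate_mem_RM hc x, by simpa using hx,
    fun j hj hj0 => hS _ (by simpa using hj) (by simpa using hj0)⟩,
    fun ⟨c, hc, hx, hS⟩ => ⟨_, comp_translate_mem_RM hc (-x), by simpa using hx,
    fun j hj hj0 => hS _ (by simpa using hj) ?_⟩⟩
  rwa [ne_eq, ← sub_eq_add_neg, sub_eq_zero]

theorem card_points (m : ℕ) : Fintype.card (Fin m → ZMod 2) = 2 ^ m := by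
  simp

theorem RMrate_eq (m d : ℕ) : RMrate m d = vol m d / 2 ^ m := by
  simp [RMrate, vol]

theorem mul_rmFail_le_rate {l : ℝ} (h0 : 0 ≤ l) (h1 : l ≤ 1) (m d : ℕ) :
    (1 - l) * rmFail l m d ≤ RMrate m d := by
  have h := mul_sum_failProb_le (C := RM m d) h0 h1
  simp only [failProb_RM, Finset.sum_const, Finset.card_univ, card_points, nsmul_eq_mul] at h
  have h2 : Real.logb 2 (shortened (RM m d) Finset.univ).card ≤ vol m d := by
    rw [Real.logb_le_iff_le_rpow one_lt_two (Nat.cast_pos.2 (card_shortened_pos _)),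
      Real.rpow_natCast]
    exact_mod_cast card_RM_le m d
  rw [RMrate_eq, le_div_iff₀ (by positivity)]
  push_cast at h
  linarith

theorem sum_pow_wt_le {s : ℝ} (hs0 : 0 ≤ s) (hs1 : s ≤ 1) (m d : ℕ) :
    ∑ c ∈ shortened (RM m d) Finset.univ, s ^ wt c
      ≤ (2 : ℝ) ^ ((2 : ℝ) ^ m * rmFail (Real.logb 2 (1 + s)) m d) := by
  have h := logb_sum_pow_weight_le (C := RM m d) hs0 hs1
  simp only [failProb_RM, Finset.sum_const, Finset.card_univ, card_points, nsmul_eq_mul] at h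
  have hl0 : 0 ≤ Real.logb 2 (1 + s) := Real.logb_nonneg one_lt_two (by linarith)
  have hl1 : Real.logb 2 (1 + s) ≤ 1 := by
    rw [Real.logb_le_iff_le_rpow one_lt_two (by linarith), Real.rpow_one]; linarith
  rw [Real.logb_le_iff_le_rpow one_lt_two] at h
  · refine h.trans (Real.rpow_le_rpow_of_exponent_le one_le_two ?_)
    push_cast
    have : 0 ≤ (2 : ℝ) ^ m * rmFail (Real.logb 2 (1 + s)) m d :=
      mul_nonneg (by positivity) (failProb_nonneg hl0 hl1 _)
    nlinarith
  · refine Finset.sum_pos' (fun c _ => pow_nonneg hs0 _) ⟨0, ?_, by simp⟩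
    exact mem_shortened_univ.2 (RM m d).zero_mem

/-- A parametrization of the hyperplane orthogonal to a nonzero vector. -/
theorem exists_linear_hyperplane {n : ℕ} {y : Fin (n + 1) → ZMod 2} (hy : y ≠ 0) :
    ∃ L : (Fin n → ZMod 2) →ₗ[ZMod 2] (Fin (n + 1) → ZMod 2), Function.Injective L ∧
      ∀ x, (∃ z, L z = x) ↔ x ⬝ᵥ y = 0 := by
  obtain ⟨i, hi⟩ := Function.ne_iff.1 hy
  have hi := zmod_two_eq_one hi
  set f : (Fin n → ZMod 2) → Fin (n + 1) → ZMod 2 :=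
    fun z => Fin.insertNth i (∑ j, z j * y (i.succAbove j)) z with hf
  have hfi : ∀ z, f z i = ∑ j, z j * y (i.succAbove j) := fun z => Fin.insertNth_apply_same _ _ _
  have hfj : ∀ z j, f z (i.succAbove j) = z j := fun z j => Fin.insertNth_apply_succAbove _ _ _ _
  have hext : ∀ u v : Fin (n + 1) → ZMod 2, u i = v i →
      (∀ j, u (i.succAbove j) = v (i.succAbove j)) → u = v := fun u v h1 h2 => by
    funext k
    rcases eq_or_ne k i with rfl | hk
    · exact h1
    · obtain ⟨j, rfl⟩ := Fin.exists_succAbove_eq hk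
      exact h2 j
  refine ⟨⟨⟨f, fun u v => hext _ _ ?_ fun j => ?_⟩, fun a u => hext _ _ ?_ fun j => ?_⟩,
    fun u v h => ?_, fun x => ⟨?_, fun hx => ⟨fun j => x (i.succAbove j), ?_⟩⟩⟩
  · simp [hfi, add_mul, Finset.sum_add_distrib]
  · simp [hfj]
  · simp [hfi, Finset.mul_sum, mul_assoc]
  · simp [hfj]
  · funext j
    have : f u = f v := h
    rw [← hfj u, ← hfj v, this]
  · rintro ⟨z, rfl⟩
    change f z ⬝ᵥ y = 0
    rw [dotProduct, Fin.sum_univ_succAbove _ i, hfi, hi]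
    simp only [hfj, mul_one]
    exact CharTwo.add_self_eq_zero _
  · refine (hext _ _ ?_ fun j => hfj _ _ : f (fun j => x (i.succAbove j)) = x)
    rw [dotProduct, Fin.sum_univ_succAbove _ i, hi, mul_one] at hx
    rw [hfi]
    exact (CharTwo.add_eq_zero.1 hx).symm

theorem fails_preimage {m n d : ℕ} (L : (Fin n → ZMod 2) →ₗ[ZMod 2] (Fin m → ZMod 2))
    (hL : Function.Injective L) {S : Finset (Fin m → ZMod 2)} (h : Fails (RM m d) 0 S) :
    Fails (RM n d) 0 (S.preimage L hL.injOn) := by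
  obtain ⟨c, hc, h0, hS⟩ := h
  refine ⟨_, comp_linear_mem_RM hc L, by simpa using h0, fun j hj hj0 => hS _ (by simpa using hj) ?_⟩
  rwa [ne_eq, map_eq_zero_iff L hL]

end ReedMuller
section Orthogonality

variable {m : ℕ}

/-- The nontrivial additive character of `ZMod 2`. -/
noncomputable def sgn (z : ZMod 2) : ℝ := if z = 0 then 1 else -1

theorem sgn_add (z w : ZMod 2) : sgn (z + w) = sgn z * sgn w := by
  have h1 : (1 : ZMod 2) + 1 = 0 := by decide
  by_cases hz : z = 0
  · simp [sgn, hz]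
  · by_cases hw : w = 0
    · simp [sgn, hw]
    · simp [sgn, zmod_two_eq_one hz, zmod_two_eq_one hw, h1]

theorem sum_sgn_dotProduct (w : Fin m → ZMod 2) :
    ∑ x : Fin m → ZMod 2, sgn (x ⬝ᵥ w) = if w = 0 then (2 : ℝ) ^ m else 0 := by
  split_ifs with h
  · subst h; simp [sgn]
  · obtain ⟨i, hi⟩ := Function.ne_iff.1 h
    have hi := zmod_two_eq_one hi
    have e : ∑ x : Fin m → ZMod 2, sgn (x ⬝ᵥ w)
        = ∑ x : Fin m → ZMod 2, -sgn (x ⬝ᵥ w) := by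
      refine Fintype.sum_equiv (Equiv.addRight (Pi.single i 1)) _ _ fun x => ?_
      rw [Equiv.coe_addRight, add_dotProduct, sgn_add, single_dotProduct, hi]
      simp [sgn]
    rw [Finset.sum_neg_distrib] at e
    linarith

/-- The vectors orthogonal to every element of `A`. -/
def annih (A : Finset (Fin m → ZMod 2)) : Finset (Fin m → ZMod 2) := {y | ∀ x ∈ A, x ⬝ᵥ y = 0}

theorem mem_annih {A : Finset (Fin m → ZMod 2)} {y : Fin m → ZMod 2} :
    y ∈ annih A ↔ ∀ x ∈ A, x ⬝ᵥ y = 0 := by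
  simp [annih]

theorem zero_mem_annih (A : Finset (Fin m → ZMod 2)) : 0 ∈ annih A := by
  simp [mem_annih]

theorem card_mul_card_annih_le (A : Finset (Fin m → ZMod 2)) :
    A.card * (annih A).card ≤ 2 ^ m := by
  set K := annih A with hK
  have hKpos : 0 < K.card := Finset.card_pos.2 ⟨0, zero_mem_annih A⟩
  have h1 : (A.card : ℝ) * K.card ^ 2 ≤ ∑ x : Fin m → ZMod 2, (∑ y ∈ K, sgn (x ⬝ᵥ y)) ^ 2 := by
    refine le_trans (le_of_eq ?_)
      (Finset.sum_le_univ_sum_of_nonneg (s := A) fun x => sq_nonneg _)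
    rw [← nsmul_eq_mul]
    refine (Finset.sum_eq_card_nsmul fun x hx => ?_).symm
    rw [Finset.sum_congr rfl (g := fun _ => (1 : ℝ)) fun y hy => by
      simp [sgn, mem_annih.1 hy x hx]]
    simp
  have h2 : ∑ x : Fin m → ZMod 2, (∑ y ∈ K, sgn (x ⬝ᵥ y)) ^ 2 = 2 ^ m * K.card := by
    simp only [sq, Finset.sum_mul_sum, ← sgn_add, ← dotProduct_add]
    rw [Finset.sum_comm]
    rw [Finset.sum_congr rfl (g := fun _ => (2 : ℝ) ^ m)]
    · simp [mul_comm]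
    · intro y hy
      rw [Finset.sum_comm, Finset.sum_congr rfl (g := fun z => if y = z then (2 : ℝ) ^ m else 0)]
      · simp [hy]
      · intro z _
        rw [sum_sgn_dotProduct]
        have : y + z = 0 ↔ y = z := by
          simp only [funext_iff, Pi.add_apply, Pi.zero_apply, CharTwo.add_eq_zero]
        simp only [this]
  rw [h2] at h1
  have hK0 : (0 : ℝ) < K.card := by exact_mod_cast hKpos
  have h3 : (A.card : ℝ) * K.card ≤ 2 ^ m := by
    refine le_of_mul_le_mul_right ?_ hK0
    linarith [h1]
  exact_mod_cast h3

theorem card_annih_erase_le {A : Finset (Fin m → ZMod 2)} {c : ℝ} (hc1 : 1 ≤ c) (hc : c ≤ A.card) :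
    (((annih A).erase 0).card : ℝ) ≤ c⁻¹ * (2 ^ m - 1) := by
  have h : (A.card : ℝ) * (annih A).card ≤ 2 ^ m := by exact_mod_cast card_mul_card_annih_le A
  rw [← Finset.insert_erase (zero_mem_annih A), Finset.card_insert_of_notMem (by simp)] at h
  push_cast at h
  rw [inv_mul_eq_div, le_div_iff₀ (by linarith)]
  have : (0 : ℝ) ≤ ((annih A).erase 0).card := by positivity
  nlinarith

theorem card_annih_erase_le_half {A : Finset (Fin m → ZMod 2)} (hA : A.Nonempty) (h0 : 0 ∉ A) :
    (((annih A).erase 0).card : ℝ) ≤ 1 / 2 * (2 ^ m - 1) := by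
  have e : annih (insert 0 A) = annih A := by ext; simp [mem_annih]
  rw [← e, one_div]
  refine card_annih_erase_le one_le_two ?_
  rw [Finset.card_insert_of_notMem h0]
  have := hA.card_pos
  push_cast
  have : (1 : ℝ) ≤ A.card := by exact_mod_cast this
  linarith

theorem card_annih_erase_le_all (A : Finset (Fin m → ZMod 2)) :
    (((annih A).erase 0).card : ℝ) ≤ 2 ^ m - 1 := by
  have h : (annih A).card ≤ 2 ^ m := by
    rw [← card_points]; exact Finset.card_le_univ _
  rw [← Finset.insert_erase (zero_mem_annih A), Finset.card_insert_of_notMem (by simp)] at h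
  have : (((annih A).erase 0).card : ℝ) + 1 ≤ 2 ^ m := by exact_mod_cast h
  linarith

end Orthogonality

section Recursion

variable {l a b : ℝ}

/-- Indicator of the failure event at the origin. -/
noncomputable def failInd (m d : ℕ) (S : Finset (Fin m → ZMod 2)) : ℝ :=
  if Fails (RM m d) 0 S then 1 else 0

theorem failInd_sq {m d : ℕ} (S : Finset (Fin m → ZMod 2)) :
    failInd m d S ^ 2 = failInd m d S := by
  rw [failInd]; split_ifs <;> norm_num

/-- Fourier coefficients of the failure event at the origin. -/
noncomputable def failCoef (l a b : ℝ) (m d : ℕ) (A : Finset (Fin m → ZMod 2)) : ℝ :=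
  coef l a b Finset.univ (failInd m d) A

theorem failCoef_empty (m d : ℕ) : failCoef l a b m d ∅ = rmFail l m d := by
  simp [failCoef, coef, chr, rmFail, failProb, failInd]

theorem failCoef_of_mem (h : IsBias l a b) {m d : ℕ} {A : Finset (Fin m → ZMod 2)} (hA : 0 ∈ A) :
    failCoef l a b m d A = 0 :=
  coef_eq_zero h (Finset.mem_univ _) hA fun S => by simp only [failInd, fails_insert_self]

theorem sum_failCoef_sq (h : IsBias l a b) (m d : ℕ) :
    ∑ A, failCoef l a b m d A ^ 2 = rmFail l m d := by
  have := sum_coef_mul_coef h Finset.univ (failInd m d) (failInd m d)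
  rw [Finset.powerset_univ] at this
  simp only [← sq, failInd_sq] at this
  exact this

theorem sq_rmFail_le (h : IsBias l a b) {n d : ℕ} {y : Fin (n + 1) → ZMod 2} (hy : y ≠ 0) :
    rmFail l (n + 1) d ^ 2 ≤ rmFail l n d *
      ∑ A, if y ∈ annih A then failCoef l a b (n + 1) d A ^ 2 else 0 := by
  obtain ⟨L, hL, hW⟩ := exists_linear_hyperplane hy
  set gW : Finset (Fin (n + 1) → ZMod 2) → ℝ := fun S => failInd n d (S.preimage L hL.injOn)
    with hgW
  have hgW1 : bexp l Finset.univ gW = rmFail l n d := by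
    rw [hgW, bexp_preimage l L hL, Finset.preimage_univ]; rfl
  have hmul : ∀ S, failInd (n + 1) d S * gW S = failInd (n + 1) d S := fun S => by
    by_cases hS : Fails (RM (n + 1) d) 0 S
    · simp [hgW, failInd, hS, fails_preimage L hL hS]
    · simp [failInd, hS]
  have hco : ∀ A, y ∉ annih A → coef l a b Finset.univ gW A = 0 := fun A hA => by
    rw [mem_annih] at hA
    push Not at hA
    obtain ⟨x, hx, hxy⟩ := hA
    refine coef_eq_zero h (Finset.mem_univ x) hx fun S => ?_
    have : (insert x S).preimage L hL.injOn = S.preimage L hL.injOn := by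
      ext z
      have : L z ≠ x := fun hz => hxy ((hW x).1 ⟨z, hz⟩)
      simp [this]
    simp only [hgW, this]
  have h1 := sum_coef_mul_coef h Finset.univ (failInd (n + 1) d) gW
  simp only [hmul, Finset.powerset_univ] at h1
  have h2 := sum_coef_mul_coef h Finset.univ gW gW
  simp only [← sq, Finset.powerset_univ] at h2
  have hgsq : ∀ S, gW S ^ 2 = gW S := fun S => failInd_sq _
  simp only [hgsq, hgW1] at h2
  have h3 : rmFail l (n + 1) d
      = ∑ A, (if y ∈ annih A then failCoef l a b (n + 1) d A else 0) *
          coef l a b Finset.univ gW A := by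
    refine Eq.trans h1.symm (Finset.sum_congr rfl fun A _ => ?_)
    split_ifs with hA
    · rfl
    · rw [hco A hA]; ring
  rw [h3]
  refine (Finset.sum_mul_sq_le_sq_mul_sq _ _ _).trans (le_of_eq ?_)
  rw [h2, mul_comm]
  congr 1
  refine Finset.sum_congr rfl fun A _ => ?_
  split_ifs <;> simp

theorem mul_sq_rmFail_le (h : IsBias l a b) (n d : ℕ) :
    ((2 : ℝ) ^ (n + 1) - 1) * rmFail l (n + 1) d ^ 2 ≤ rmFail l n d *
      ∑ A, failCoef l a b (n + 1) d A ^ 2 * ((annih A).erase 0).card := by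
  have hs := Finset.sum_le_sum fun (y : Fin (n + 1) → ZMod 2)
    (hy : y ∈ Finset.univ.erase 0) => sq_rmFail_le h (d := d) (Finset.ne_of_mem_erase hy)
  rw [← Finset.mul_sum, Finset.sum_comm, Finset.sum_const, nsmul_eq_mul,
    Finset.card_erase_of_mem (Finset.mem_univ _), Finset.card_univ, card_points,
    Nat.cast_pred (by positivity)] at hs
  push_cast at hs
  refine hs.trans (le_of_eq ?_)
  congr 1
  refine Finset.sum_congr rfl fun A _ => ?_
  rw [← Finset.sum_filter, Finset.sum_const, nsmul_eq_mul, mul_comm]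
  congr 3
  ext y
  simp

theorem rmFail_nonneg (h0 : 0 ≤ l) (h1 : l ≤ 1) (m d : ℕ) : 0 ≤ rmFail l m d :=
  failProb_nonneg h0 h1 _

theorem rmFail_succ_le_of_sum_le (h : IsBias l a b) {n d : ℕ} {c : ℝ} (hc : 0 ≤ c)
    (hsum : ∑ A, failCoef l a b (n + 1) d A ^ 2 * ((annih A).erase 0).card
      ≤ ((2 : ℝ) ^ (n + 1) - 1) * (rmFail l (n + 1) d * c)) :
    rmFail l (n + 1) d ≤ rmFail l n d * c := by
  have h0 := rmFail_nonneg h.pos.le h.lt_one.le n d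
  rcases (rmFail_nonneg h.pos.le h.lt_one.le (n + 1) d).eq_or_lt with h1 | h1
  · rw [← h1]; positivity
  · have h2 := (mul_sq_rmFail_le h n d).trans (mul_le_mul_of_nonneg_left hsum h0)
    have h3 : (1 : ℝ) < 2 ^ (n + 1) := one_lt_pow₀ one_lt_two (by omega)
    have h4 : ((2 : ℝ) ^ (n + 1) - 1) * rmFail l (n + 1) d * rmFail l (n + 1) d
        ≤ ((2 : ℝ) ^ (n + 1) - 1) * rmFail l (n + 1) d * (rmFail l n d * c) := by linarith
    exact le_of_mul_le_mul_left h4 (mul_pos (by linarith) h1)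

theorem rmFail_succ_le_half (h : IsBias l a b) (n d : ℕ) :
    rmFail l (n + 1) d ≤ rmFail l n d * ((1 + rmFail l (n + 1) d) / 2) := by
  have h0 := rmFail_nonneg h.pos.le h.lt_one.le (n + 1) d
  refine rmFail_succ_le_of_sum_le h (by linarith) ?_
  have h3 : (1 : ℝ) ≤ 2 ^ (n + 1) := one_le_pow₀ one_le_two
  calc ∑ A, failCoef l a b (n + 1) d A ^ 2 * ((annih A).erase 0).card
      ≤ ∑ A, (failCoef l a b (n + 1) d A ^ 2 * (1 / 2 * ((2 : ℝ) ^ (n + 1) - 1))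
          + if A = ∅ then rmFail l (n + 1) d ^ 2 * (1 / 2 * ((2 : ℝ) ^ (n + 1) - 1)) else 0) := by
        refine Finset.sum_le_sum fun A _ => ?_
        split_ifs with hA
        · subst hA
          rw [failCoef_empty]
          have := mul_le_mul_of_nonneg_left
            (card_annih_erase_le_all (∅ : Finset (Fin (n + 1) → ZMod 2)))
            (sq_nonneg (rmFail l (n + 1) d))
          linarith
        · rw [add_zero]
          by_cases hA0 : 0 ∈ A
          · simp [failCoef_of_mem h hA0]
          · exact mul_le_mul_of_nonneg_left
              (card_annih_erase_le_half (Finset.nonempty_iff_ne_empty.2 hA) hA0) (sq_nonneg _)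
    _ = _ := by
        rw [Finset.sum_add_distrib, ← Finset.sum_mul, sum_failCoef_sq h]
        simp only [Finset.sum_ite_eq', Finset.mem_univ, if_true]
        ring

theorem rmFail_succ_le_of_le_pow (h : IsBias l a b) {r : ℝ} (hr : 0 < r) (hr1 : r ≤ 1)
    (hs : IsSmallNoise l a b r) {n d : ℕ} (k : ℕ) {t : ℝ} (ht : 0 ≤ t)
    (hle : rmFail l (n + 1) d ≤ t ^ 4) :
    rmFail l (n + 1) d ≤ rmFail l n d * ((2 ^ k)⁻¹ + (r ^ 2 ^ k)⁻¹ * t) := by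
  have h0 := rmFail_nonneg h.pos.le h.lt_one.le (n + 1) d
  refine rmFail_succ_le_of_sum_le h (by positivity) ?_
  have h3 : (1 : ℝ) ≤ 2 ^ (n + 1) := one_le_pow₀ one_le_two
  have hst : ∑ A, r ^ A.card * failCoef l a b (n + 1) d A ^ 2 ≤ rmFail l (n + 1) d * t := by
    refine le_of_pow_le_pow_left₀ four_ne_zero (by positivity) ?_
    have := noise_stability_pow_four_le h hr.le hs Finset.univ (failInd (n + 1) d) failInd_sq
    rw [Finset.powerset_univ] at this
    refine this.trans ?_
    change rmFail l (n + 1) d ^ 5 ≤ _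
    rw [pow_succ, mul_pow]
    exact mul_le_mul_of_nonneg_left hle (by positivity)
  calc ∑ A, failCoef l a b (n + 1) d A ^ 2 * ((annih A).erase 0).card
      ≤ ∑ A, ((2 : ℝ) ^ (n + 1) - 1) * ((2 ^ k)⁻¹ * failCoef l a b (n + 1) d A ^ 2
          + (r ^ 2 ^ k)⁻¹ * (r ^ A.card * failCoef l a b (n + 1) d A ^ 2)) := by
        refine Finset.sum_le_sum fun A _ => ?_
        have hN : (((annih A).erase 0).card : ℝ)
            ≤ ((2 : ℝ) ^ (n + 1) - 1) * ((2 ^ k)⁻¹ + (r ^ 2 ^ k)⁻¹ * r ^ A.card) := by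
          have h4 : (0 : ℝ) ≤ 2 ^ (n + 1) - 1 := by linarith
          rcases le_or_gt (2 ^ k) A.card with hA | hA
          · refine (card_annih_erase_le (c := 2 ^ k) (one_le_pow₀ one_le_two)
              (by exact_mod_cast hA)).trans ?_
            rw [mul_comm]
            refine mul_le_mul_of_nonneg_left ?_ h4
            have : 0 ≤ (r ^ 2 ^ k)⁻¹ * r ^ A.card := by positivity
            linarith
          · refine (card_annih_erase_le_all A).trans (le_mul_of_one_le_right h4 ?_)
            have h5 : 1 ≤ (r ^ 2 ^ k)⁻¹ * r ^ A.card := by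
              rw [inv_mul_eq_div, one_le_div (by positivity)]
              exact pow_le_pow_of_le_one hr.le hr1 hA.le
            have : (0 : ℝ) ≤ (2 ^ k)⁻¹ := by positivity
            linarith
        refine (mul_le_mul_of_nonneg_left hN (sq_nonneg _)).trans (le_of_eq ?_)
        ring
    _ = ((2 : ℝ) ^ (n + 1) - 1) * ((2 ^ k)⁻¹ * rmFail l (n + 1) d
          + (r ^ 2 ^ k)⁻¹ * ∑ A, r ^ A.card * failCoef l a b (n + 1) d A ^ 2) := by
        rw [← Finset.mul_sum, Finset.sum_add_distrib, ← Finset.mul_sum, ← Finset.mul_sum,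
          sum_failCoef_sq h]
    _ ≤ _ := by
        refine mul_le_mul_of_nonneg_left ?_ (by linarith)
        have : (r ^ 2 ^ k)⁻¹ * ∑ A, r ^ A.card * failCoef l a b (n + 1) d A ^ 2
            ≤ (r ^ 2 ^ k)⁻¹ * (rmFail l (n + 1) d * t) :=
          mul_le_mul_of_nonneg_left hst (by positivity)
        linarith

end Recursion
section Iteration

variable {l a b : ℝ}

theorem rmFail_add_le (h : IsBias l a b) {κ : ℝ} (hκ0 : 0 < κ) (hκ1 : κ ≤ 1) {m d : ℕ}
    (h0 : rmFail l m d ≤ 1 - κ) (j : ℕ) :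
    κ * 2 ^ j * rmFail l (m + j) d ≤ 1 - rmFail l (m + j) d := by
  induction j with
  | zero =>
    rw [pow_zero, mul_one, add_zero]
    nlinarith
  | succ j ih =>
    have h1 := rmFail_succ_le_half h (m + j) d
    have h2 := rmFail_nonneg h.pos.le h.lt_one.le (m + j) d
    have h3 := rmFail_nonneg h.pos.le h.lt_one.le (m + j + 1) d
    rw [← add_assoc, pow_succ]
    set x := rmFail l (m + j) d
    set y := rmFail l (m + j + 1) d
    have hK : 0 < κ * 2 ^ j := by positivity
    set K := κ * 2 ^ j
    have h4 : (K + 1) * x * (1 + y) ≤ 1 * (1 + y) :=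
      mul_le_mul_of_nonneg_right (by linarith) (by linarith)
    have h5 : (K + 1) * y ≤ (K + 1) * (x * ((1 + y) / 2)) :=
      mul_le_mul_of_nonneg_left h1 (by linarith)
    have : κ * (2 ^ j * 2) * y = 2 * (K * y) := by simp only [K]; ring
    rw [this]
    linarith

theorem rmFail_add_le_div (h : IsBias l a b) {κ : ℝ} (hκ0 : 0 < κ) (hκ1 : κ ≤ 1) {m d : ℕ}
    (h0 : rmFail l m d ≤ 1 - κ) (j : ℕ) : rmFail l (m + j) d ≤ (1 / 2) ^ j / κ := by
  have h1 := rmFail_add_le h hκ0 hκ1 h0 j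
  have h2 := rmFail_nonneg h.pos.le h.lt_one.le (m + j) d
  rw [le_div_iff₀ hκ0, one_div, inv_pow, ← one_div, le_div_iff₀ (by positivity)]
  linarith

/-- Doubly exponential amplification of a nontrivial bound on the failure probability. -/
theorem rmFail_amplify (h : IsBias l a b) {r : ℝ} (hr : 0 < r) (hr1 : r ≤ 1)
    (hs : IsSmallNoise l a b r) {κ : ℝ} (hκ0 : 0 < κ) (hκ1 : κ ≤ 1) {m d u k : ℕ}
    (h0 : rmFail l m d ≤ 1 - κ) (hu : (1 / 2) ^ u / κ ≤ (1 / 2) ^ (k + 1) * r ^ 2 ^ (k + 1)) :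
    rmFail l (m + 2 * (4 * u)) d ≤ (1 / 2) ^ (k * (4 * u)) := by
  have hbound : ∀ j, 4 * u ≤ j → rmFail l (m + j) d ≤ ((1 / 2) ^ u / κ) ^ 4 := fun j hj => by
    refine (rmFail_add_le_div h hκ0 hκ1 h0 j).trans ?_
    rw [div_pow _ κ, ← pow_mul, mul_comm u]
    exact div_le_div₀ (by positivity) (pow_le_pow_of_le_one (by norm_num) (by norm_num) hj)
      (by positivity) (pow_le_of_le_one hκ0.le hκ1 four_ne_zero)
  have hstep : ∀ i, rmFail l (m + 4 * u + i) d ≤ ((1 / 2) ^ k) ^ i := fun i => by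
    induction i with
    | zero =>
      have := rmFail_add_le h hκ0 hκ1 h0 (4 * u)
      have h2 := rmFail_nonneg h.pos.le h.lt_one.le (m + 4 * u) d
      have h3 : 0 ≤ κ * 2 ^ (4 * u) * rmFail l (m + 4 * u) d := by positivity
      rw [pow_zero, add_zero]
      linarith
    | succ i ih =>
      have hb := hbound (4 * u + (i + 1)) (by omega)
      rw [← add_assoc, ← add_assoc] at hb
      have h1 := rmFail_succ_le_of_le_pow h hr hr1 hs (k + 1) (by positivity) hb
      rw [← add_assoc, pow_succ]
      refine h1.trans (mul_le_mul ih ?_ (by positivity) (by positivity))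
      have h2 : (r ^ 2 ^ (k + 1))⁻¹ * ((1 / 2) ^ u / κ) ≤ (1 / 2) ^ (k + 1) := by
        rw [inv_mul_le_iff₀ (by positivity), mul_comm]
        exact hu
      have h3 : ((2 : ℝ) ^ (k + 1))⁻¹ = (1 / 2) ^ (k + 1) := by rw [one_div, inv_pow]
      have h4 : ((1 : ℝ) / 2) ^ (k + 1) = (1 / 2) ^ k / 2 := by rw [pow_succ]; ring
      linarith
  have := hstep (4 * u)
  rwa [← pow_mul, add_assoc, ← two_mul] at this

end Iteration
section Derivative

variable {m k : ℕ}

/-- Sum of `f` over the affine flat through `x` with direction vectors `L`. -/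
def der (L : Fin k → Fin m → ZMod 2) :
    ((Fin m → ZMod 2) → ZMod 2) →ₗ[ZMod 2] ((Fin m → ZMod 2) → ZMod 2) where
  toFun f x := ∑ c : Fin k → ZMod 2, f (x + ∑ i, c i • L i)
  map_add' f g := by funext x; simp [Finset.sum_add_distrib]
  map_smul' a f := by funext x; simp [Finset.mul_sum]

theorem der_apply (L : Fin k → Fin m → ZMod 2) (f : (Fin m → ZMod 2) → ZMod 2)
    (x : Fin m → ZMod 2) : der L f x = ∑ c : Fin k → ZMod 2, f (x + ∑ i, c i • L i) := rfl

theorem der_eq_zero {L : Fin k → Fin m → ZMod 2} {f : (Fin m → ZMod 2) → ZMod 2}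
    {c₀ : Fin k → ZMod 2} (hc₀ : c₀ ≠ 0) (hf : ∀ x, f (x + ∑ i, c₀ i • L i) = f x) :
    der L f = 0 := by
  funext x
  rw [der_apply]
  refine Finset.sum_involution (fun c _ => c + c₀) (fun c _ => ?_) (fun c _ _ => ?_)
    (fun c _ => Finset.mem_univ _) fun c _ => ?_
  · simp only [Pi.add_apply, add_smul, Finset.sum_add_distrib]
    rw [← add_assoc, hf]
    exact CharTwo.add_self_eq_zero _
  · simpa using hc₀
  · funext i
    simp only [Pi.add_apply, add_assoc, CharTwo.add_self_eq_zero, add_zero]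

theorem card_eval_ne_zero_mul {f : (Fin m → ZMod 2) → ZMod 2} {c : Fin k → ZMod 2} (hc : c ≠ 0)
    (x : Fin m → ZMod 2) :
    (Finset.univ.filter fun L : Fin k → Fin m → ZMod 2 => f (x + ∑ i, c i • L i) ≠ 0).card * 2 ^ m
      = Fintype.card (Fin k → Fin m → ZMod 2) * wt f := by
  obtain ⟨j, hj⟩ := Function.ne_iff.1 hc
  have hj := zmod_two_eq_one hj
  have h1 : ∀ v : Fin m → ZMod 2,
      (Finset.univ.filter fun L : Fin k → Fin m → ZMod 2 => f (x + ∑ i, c i • L i) ≠ 0).card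
        = (Finset.univ.filter fun L : Fin k → Fin m → ZMod 2 =>
            f (x + ∑ i, c i • L i + v) ≠ 0).card := fun v => by
    refine (Finset.card_equiv (Equiv.addRight (Pi.single j v)) fun L => ?_).symm
    have : ∑ i, c i • (Pi.single j v : Fin k → Fin m → ZMod 2) i = v := by
      rw [Finset.sum_eq_single j]
      · simp [hj]
      · intro i _ hi; simp [hi]
      · simp
    simp only [Finset.mem_filter, Finset.mem_univ, true_and, Equiv.coe_addRight, Pi.add_apply,
      smul_add, Finset.sum_add_distrib, this, add_assoc]
  have h2 : ∑ v : Fin m → ZMod 2, (Finset.univ.filter fun L : Fin k → Fin m → ZMod 2 =>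
      f (x + ∑ i, c i • L i + v) ≠ 0).card = Fintype.card (Fin k → Fin m → ZMod 2) * wt f := by
    simp only [Finset.card_filter]
    rw [Finset.sum_comm, ← Finset.card_univ, ← smul_eq_mul]
    refine Finset.sum_eq_card_nsmul fun L _ => ?_
    rw [wt, Finset.card_filter]
    exact Fintype.sum_equiv (Equiv.addLeft _) _ _ fun v => rfl
  rw [← h2, ← Finset.sum_congr rfl fun v _ => h1 v]
  simp [mul_comm]

theorem card_der_ne_le {f : (Fin m → ZMod 2) → ZMod 2} (hf : wt f * 2 ^ (k + 2) ≤ 2 ^ m)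
    (x : Fin m → ZMod 2) :
    4 * (Finset.univ.filter fun L : Fin k → Fin m → ZMod 2 => der L f x ≠ f x).card
      ≤ Fintype.card (Fin k → Fin m → ZMod 2) := by
  have hsub : (Finset.univ.filter fun L : Fin k → Fin m → ZMod 2 => der L f x ≠ f x)
      ⊆ (Finset.univ.erase (0 : Fin k → ZMod 2)).biUnion fun c =>
        Finset.univ.filter fun L : Fin k → Fin m → ZMod 2 => f (x + ∑ i, c i • L i) ≠ 0 := by
    intro L hL
    by_contra hcon
    simp only [Finset.mem_biUnion, Finset.mem_erase, Finset.mem_univ, and_true, Finset.mem_filter,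
      true_and, not_exists, not_and, not_not] at hcon
    refine (Finset.mem_filter.1 hL).2 ?_
    rw [der_apply, Finset.sum_eq_single 0 (fun c _ hc => hcon c hc) (by simp)]
    simp
  have h1 := (Finset.card_le_card hsub).trans Finset.card_biUnion_le
  have h2 : (Finset.univ.filter fun L : Fin k → Fin m → ZMod 2 => der L f x ≠ f x).card * 2 ^ m
      ≤ 2 ^ k * (Fintype.card (Fin k → Fin m → ZMod 2) * wt f) := by
    refine (Nat.mul_le_mul_right _ h1).trans ?_
    rw [Finset.sum_mul, Finset.sum_congr rfl fun c hc =>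
      card_eval_ne_zero_mul (Finset.ne_of_mem_erase hc) x, Finset.sum_const, smul_eq_mul]
    refine Nat.mul_le_mul_right _ ?_
    rw [← card_points]
    exact Finset.card_le_univ _
  refine Nat.le_of_mul_le_mul_right (c := 2 ^ m) ?_ (by positivity)
  calc _ ≤ 4 * (2 ^ k * (Fintype.card (Fin k → Fin m → ZMod 2) * wt f)) := by
        rw [mul_assoc]; exact Nat.mul_le_mul_left _ h2
    _ = Fintype.card (Fin k → Fin m → ZMod 2) * (wt f * 2 ^ (k + 2)) := by rw [pow_add]; ring
    _ ≤ _ := Nat.mul_le_mul_left _ hf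

/-- If every point has few bad elements of `α`, then some short tuple is good in the majority of
its entries at every point. -/
theorem exists_majority_tuple {X α : Type*} [Fintype X] [Fintype α] [Nonempty α] {m : ℕ}
    (hX : Fintype.card X = 2 ^ m) (Bad : X → α → Prop)
    (hBad : ∀ x, 4 * (Finset.univ.filter (Bad x)).card ≤ Fintype.card α) :
    ∃ T : Fin (6 * (m + 1)) → α, ∀ x,
      2 * (Finset.univ.filter fun j => Bad x (T j)).card < 6 * (m + 1) := by
  by_contra! hcon
  set t := 6 * (m + 1) with ht
  have h1 : ∀ x, 8 ^ t * (Finset.univ.filter fun T : Fin t → α =>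
      t ≤ 2 * (Finset.univ.filter fun j => Bad x (T j)).card).card ≤ 7 ^ t * Fintype.card α ^ t := by
    intro x
    set B := Finset.univ.filter fun T : Fin t → α =>
      t ≤ 2 * (Finset.univ.filter fun j => Bad x (T j)).card with hB
    have h2 : B.card * 2 ^ t ≤ ∑ T : Fin t → α, ∏ j, if Bad x (T j) then 4 else 1 := by
      rw [← smul_eq_mul]
      refine (Finset.card_nsmul_le_sum B _ _ fun T hT => ?_).trans
        (Finset.sum_le_univ_sum_of_nonneg fun T => Nat.zero_le _)
      rw [Finset.prod_ite, Finset.prod_const, Finset.prod_const_one, mul_one,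
        show (4 : ℕ) = 2 ^ 2 by norm_num, ← pow_mul]
      exact Nat.pow_le_pow_right two_pos (Finset.mem_filter.1 hT).2
    have hpow := Fintype.sum_pow (fun a => if Bad x a then 4 else 1) t
    rw [← hpow] at h2
    have h3 : ∑ a, (if Bad x a then 4 else 1)
        = Fintype.card α + 3 * (Finset.univ.filter (Bad x)).card := by
      rw [Finset.card_filter, Finset.mul_sum, ← Finset.card_univ, Finset.card_eq_sum_ones,
        ← Finset.sum_add_distrib]
      exact Finset.sum_congr rfl fun a _ => by split_ifs <;> rfl
    have h4 : 4 * ∑ a, (if Bad x a then 4 else 1) ≤ 7 * Fintype.card α := by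
      rw [h3]; have := hBad x; omega
    calc 8 ^ t * B.card = 4 ^ t * (B.card * 2 ^ t) := by
          rw [show (8 : ℕ) = 4 * 2 by norm_num, mul_pow]; ring
      _ ≤ 4 ^ t * (∑ a, (if Bad x a then 4 else 1)) ^ t := Nat.mul_le_mul_left _ h2
      _ ≤ _ := by rw [← mul_pow, ← mul_pow]; exact Nat.pow_le_pow_left h4 t
  have h2 : Fintype.card α ^ t ≤ ∑ x, (Finset.univ.filter fun T : Fin t → α =>
      t ≤ 2 * (Finset.univ.filter fun j => Bad x (T j)).card).card := by
    refine le_trans (le_of_eq ?_) ((Finset.card_le_card (s := Finset.univ) fun T _ => ?_).trans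
      Finset.card_biUnion_le)
    · simp
    · obtain ⟨x, hx⟩ := hcon T
      exact Finset.mem_biUnion.2 ⟨x, Finset.mem_univ x, by simpa using hx⟩
  have h3 : 8 ^ t * Fintype.card α ^ t ≤ 2 ^ m * 7 ^ t * Fintype.card α ^ t := by
    refine (Nat.mul_le_mul_left _ h2).trans ?_
    rw [Finset.mul_sum, ← hX, ← Finset.card_univ, mul_assoc, ← smul_eq_mul]
    exact Finset.sum_le_card_nsmul _ _ _ fun x _ => h1 x
  have h4 := Nat.le_of_mul_le_mul_right h3 (pow_pos Fintype.card_pos t)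
  have h5 : 2 ^ m * 7 ^ t < 8 ^ t := by
    calc 2 ^ m * 7 ^ t < 2 ^ (m + 1) * 7 ^ t :=
          Nat.mul_lt_mul_of_pos_right (Nat.pow_lt_pow_right one_lt_two (Nat.lt_succ_self m))
            (by positivity)
      _ = (2 * 7 ^ 6) ^ (m + 1) := by rw [ht, pow_mul, ← mul_pow]
      _ ≤ (8 ^ 6) ^ (m + 1) := Nat.pow_le_pow_left (by norm_num) _
      _ = _ := by rw [ht, pow_mul]
  omega

/-- A linear change of coordinates taking given independent vectors to coordinate vectors. -/
theorem exists_coordinates {L : Fin k → Fin m → ZMod 2} (hL : LinearIndependent (ZMod 2) L) :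
    ∃ (A : (Fin m → ZMod 2) ≃ₗ[ZMod 2] (Fin m → ZMod 2)) (σ : Fin k ↪ Fin m),
      ∀ i, A (Pi.single (σ i) 1) = L i := by
  set b := Module.Basis.extend hL.linearIndepOn_id with hb
  set e := b.indexEquiv (Pi.basisFun (ZMod 2) (Fin m))
  have hmem : ∀ i, L i ∈ hL.linearIndepOn_id.extend (Set.subset_univ _) := fun i =>
    Module.Basis.subset_extend _ ⟨i, rfl⟩
  have hinj : Function.Injective fun i => e ⟨L i, hmem i⟩ := fun i j hij =>
    hL.injective (Subtype.ext_iff.1 (e.injective hij))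
  refine ⟨(b.reindex e).equivFun.symm, ⟨fun i => e ⟨L i, hmem i⟩, hinj⟩, fun i => ?_⟩
  · change (b.reindex e).equivFun.symm (Pi.single (e ⟨L i, hmem i⟩) 1) = L i
    rw [Module.Basis.equivFun_symm_apply, Finset.sum_eq_single (e ⟨L i, hmem i⟩)]
    · simp [hb]
    · intro j _ hj
      rw [Pi.single_eq_of_ne hj, zero_smul]
    · simp

theorem card_supersets_le (σ : Fin k ↪ Fin m) (d : ℕ) :
    ((lowSets m d).filter fun I => ∀ i, σ i ∈ I).card
      ≤ if k ≤ d then vol (m - k) (d - k) else 0 := by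
  set T := Finset.univ.map σ with hT
  have hTc : T.card = k := by simp [hT]
  have hsub : ∀ I : Finset (Fin m), (∀ i, σ i ∈ I) → T ⊆ I := fun I hI j hj => by
    obtain ⟨i, -, rfl⟩ := Finset.mem_map.1 hj
    exact hI i
  split_ifs with hkd
  · have h1 : ((lowSets m d).filter fun I => ∀ i, σ i ∈ I).card
        ≤ ((Finset.range (d - k + 1)).biUnion fun i => Finset.powersetCard i Tᶜ).card := by
      refine Finset.card_le_card_of_injOn (fun I => I \ T) (fun I hI => ?_) fun I hI J hJ h => ?_
      · simp only [Finset.coe_filter, Set.mem_ofPred_eq, mem_lowSets] at hI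
        simp only [Finset.coe_biUnion, Set.mem_iUnion, Finset.mem_coe, Finset.mem_powersetCard,
          Finset.mem_range]
        refine ⟨(I \ T).card, ?_, fun j hj => by simpa using (Finset.mem_sdiff.1 hj).2, rfl⟩
        rw [Finset.card_sdiff_of_subset (hsub I hI.2), hTc]
        omega
      · simp only [Finset.coe_filter, Set.mem_ofPred_eq] at hI hJ
        have h : I \ T = J \ T := h
        rw [← Finset.sdiff_union_of_subset (hsub I hI.2), h,
          Finset.sdiff_union_of_subset (hsub J hJ.2)]
    refine h1.trans (Finset.card_biUnion_le.trans (le_of_eq ?_))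
    simp [vol, Finset.card_compl, hTc]
  · rw [Nat.le_zero, Finset.card_eq_zero, Finset.filter_eq_empty_iff]
    intro I hI hI2
    have := Finset.card_le_card (hsub I hI2)
    rw [mem_lowSets] at hI
    omega

theorem der_mono_eq_zero {σ : Fin k ↪ Fin m} {I : Finset (Fin m)} {i : Fin k} (hi : σ i ∉ I) :
    der (fun j => Pi.single (σ j) 1) (mono I) = 0 := by
  refine der_eq_zero (c₀ := Pi.single i 1) (by simp) fun x => ?_
  rw [Finset.sum_eq_single i (fun j _ hj => by simp [hj]) (by simp)]
  refine Finset.prod_congr rfl fun j hj => ?_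
  have : j ≠ σ i := fun h => hi (h ▸ hj)
  simp [this]

theorem card_image_der_coordinates_le (σ : Fin k ↪ Fin m) (d : ℕ) :
    ((shortened (RM m d) Finset.univ).image (der fun j => Pi.single (σ j) 1)).card
      ≤ 2 ^ (if k ≤ d then vol (m - k) (d - k) else 0) := by
  set D := der fun j => (Pi.single (σ j) 1 : Fin m → ZMod 2) with hD
  set G := ((lowSets m d).filter fun I => ∀ i, σ i ∈ I).image fun I => D (mono I) with hG
  have hmem : ∀ f ∈ RM m d, D f ∈ Submodule.span (ZMod 2) (G : Set ((Fin m → ZMod 2) → ZMod 2)) := by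
    intro f hf
    have h := Submodule.mem_map_of_mem (f := D) (RM_le_span m d hf)
    rw [Submodule.map_span] at h
    refine Submodule.span_le.2 ?_ h
    rintro _ ⟨_, hg, rfl⟩
    obtain ⟨I, hI, rfl⟩ := Finset.mem_image.1 (Finset.mem_coe.1 hg)
    by_cases hσ : ∀ i, σ i ∈ I
    · exact Submodule.subset_span (Finset.mem_coe.2
        (Finset.mem_image.2 ⟨I, Finset.mem_filter.2 ⟨hI, hσ⟩, rfl⟩))
    · push Not at hσ
      obtain ⟨i, hi⟩ := hσ
      rw [SetLike.mem_coe, hD, der_mono_eq_zero hi]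
      exact Submodule.zero_mem _
  refine (Finset.card_le_card fun g hg => ?_).trans ((card_span_le G).trans
    (Nat.pow_le_pow_right two_pos (Finset.card_image_le.trans (card_supersets_le σ d))))
  obtain ⟨f, hf, rfl⟩ := Finset.mem_image.1 hg
  simpa using hmem f (mem_shortened_univ.1 hf)

theorem card_image_der_le (L : Fin k → Fin m → ZMod 2) (d : ℕ) :
    ((shortened (RM m d) Finset.univ).image (der L)).card
      ≤ 2 ^ (if k ≤ d then vol (m - k) (d - k) else 0) := by
  by_cases hL : LinearIndependent (ZMod 2) L
  · obtain ⟨A, σ, hA⟩ := exists_coordinates hL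
    refine le_trans ?_ (card_image_der_coordinates_le σ d)
    refine Finset.card_le_card_of_injOn (fun g x => g (A x)) (fun g hg => ?_) fun g _ g' _ h => ?_
    · obtain ⟨f, hf, rfl⟩ := Finset.mem_image.1 (Finset.mem_coe.1 hg)
      refine Finset.mem_coe.2 (Finset.mem_image.2 ⟨fun x => f (A x), ?_, ?_⟩)
      · rw [mem_shortened_univ] at hf ⊢
        exact comp_linear_mem_RM hf A.toLinearMap
      · funext x
        simp only [der_apply, map_add, map_sum, map_smul, hA]
    · funext x
      simpa using congrFun h (A.symm x)
  · rw [Fintype.not_linearIndependent_iff] at hL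
    obtain ⟨c, hc, i, hi⟩ := hL
    have hD : ∀ f, der L f = 0 := fun f =>
      der_eq_zero (c₀ := c) (fun h => hi (by rw [h]; rfl)) fun x => by rw [hc, add_zero]
    refine (Finset.card_le_card (t := {0}) fun g hg => ?_).trans ?_
    · obtain ⟨f, -, rfl⟩ := Finset.mem_image.1 hg
      simp [hD]
    · rw [Finset.card_singleton]; exact Nat.one_le_two_pow

/-- The number of low-weight codewords. -/
theorem card_low_weight_le (m d k : ℕ) :
    ((shortened (RM m d) Finset.univ).filter fun f => wt f * 2 ^ (k + 2) ≤ 2 ^ m).card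
      ≤ (2 ^ (m * k + if k ≤ d then vol (m - k) (d - k) else 0)) ^ (6 * (m + 1)) := by
  set F := (shortened (RM m d) Finset.univ).filter fun f => wt f * 2 ^ (k + 2) ≤ 2 ^ m with hF
  set t := 6 * (m + 1) with ht
  have hex : ∀ f : (Fin m → ZMod 2) → ZMod 2, ∃ T : Fin t → Fin k → Fin m → ZMod 2, f ∈ F →
      ∀ x, 2 * (Finset.univ.filter fun j => der (T j) f x ≠ f x).card < t := fun f => by
    by_cases hf : f ∈ F
    · obtain ⟨T, hT⟩ := exists_majority_tuple (card_points m)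
        (fun x (L : Fin k → Fin m → ZMod 2) => der L f x ≠ f x)
        (fun x => by convert card_der_ne_le (Finset.mem_filter.1 hf).2 x)
      exact ⟨T, fun _ x => by convert hT x⟩
    · exact ⟨0, fun h => absurd h hf⟩
  choose T hT using hex
  rw [Finset.card_eq_sum_card_fiberwise (f := T) (t := Finset.univ) fun _ _ => Finset.mem_univ _]
  have hfib : ∀ τ : Fin t → Fin k → Fin m → ZMod 2, (F.filter fun f => T f = τ).card
      ≤ (2 ^ (if k ≤ d then vol (m - k) (d - k) else 0)) ^ t := fun τ => by
    have h1 : (F.filter fun f => T f = τ).card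
        ≤ (Fintype.piFinset fun j => (shortened (RM m d) Finset.univ).image (der (τ j))).card := by
      refine Finset.card_le_card_of_injOn (fun f j => der (τ j) f) (fun f hf => ?_)
        fun f hf g hg h => ?_
      · rw [Finset.mem_coe, Finset.mem_filter] at hf
        exact Finset.mem_coe.2 (Fintype.mem_piFinset.2 fun j =>
          Finset.mem_image_of_mem _ (Finset.mem_filter.1 hf.1).1)
      · rw [Finset.mem_coe, Finset.mem_filter] at hf hg
        obtain ⟨hf, rfl⟩ := hf
        obtain ⟨hg, hgf⟩ := hg
        funext x
        by_contra hne
        have h2 := hT f hf x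
        have h3 := hT g hg x
        rw [hgf] at h3
        have h4 : (Finset.univ : Finset (Fin t)) ⊆
            (Finset.univ.filter fun j => der (T f j) f x ≠ f x) ∪
              Finset.univ.filter fun j => der (T f j) g x ≠ g x := fun j _ => by
          have h5 : der (T f j) f = der (T f j) g := congrFun h j
          simp only [Finset.mem_union, Finset.mem_filter, Finset.mem_univ, true_and, h5]
          by_contra! h6
          exact hne (h6.1.symm.trans h6.2)
        have h5 := (Finset.card_le_card h4).trans (Finset.card_union_le _ _)
        rw [Finset.card_univ, Fintype.card_fin] at h5
        omega
    refine h1.trans ?_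
    rw [Fintype.card_piFinset]
    refine (Finset.prod_le_prod' fun j _ => card_image_der_le (τ j) d).trans (le_of_eq ?_)
    simp
  refine (Finset.sum_le_card_nsmul _ _ _ fun τ _ => hfib τ).trans (le_of_eq ?_)
  simp only [Finset.card_univ, Fintype.card_fun, Fintype.card_fin, ZMod.card, smul_eq_mul]
  rw [pow_add, mul_pow]
  congr 1
  simp only [← pow_mul, ht]

theorem eq_zero_of_low_weight {m d k : ℕ} (hk : d < k) {f : (Fin m → ZMod 2) → ZMod 2}
    (hf : f ∈ RM m d) (hw : wt f * 2 ^ (k + 2) ≤ 2 ^ m) : f = 0 := by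
  have hD : ∀ L : Fin k → Fin m → ZMod 2, der L f = 0 := fun L => by
    have h := card_image_der_le L d
    rw [if_neg (by omega), pow_zero, Finset.card_le_one] at h
    exact h _ (Finset.mem_image_of_mem _ (mem_shortened_univ.2 hf)) _
      (Finset.mem_image.2 ⟨0, mem_shortened_univ.2 (RM m d).zero_mem, map_zero _⟩)
  funext x
  by_contra hx
  have h := card_der_ne_le hw x
  rw [Finset.filter_true_of_mem fun L _ => by rw [hD]; exact fun h => hx h.symm,
    Finset.card_univ] at h
  have : 0 < Fintype.card (Fin k → Fin m → ZMod 2) := Fintype.card_pos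
  omega

end Derivative
section Binomials

theorem vol_le_exp (n k : ℕ) {t : ℝ} (ht : 0 ≤ t) :
    (vol n k : ℝ) ≤ 2 ^ n * Real.exp (t * (2 * k - n) + n * t ^ 2 / 2) := by
  have h1 : (vol n k : ℝ) ≤ ∑ i ∈ Finset.range (n + 1),
      (n.choose i : ℝ) * Real.exp (t * (2 * k - 2 * i)) := by
    rw [Finset.sum_subset (Finset.range_subset_range.2 (show n + 1 ≤ n + k + 1 by omega))
      fun i _ hi => by
        rw [Nat.choose_eq_zero_of_lt (by rw [Finset.mem_range] at hi; omega), Nat.cast_zero,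
          zero_mul], vol, Nat.cast_sum]
    refine (Finset.sum_le_sum fun i hi => ?_).trans (Finset.sum_le_sum_of_subset_of_nonneg
      (Finset.range_subset_range.2 (show k + 1 ≤ n + k + 1 by omega)) fun i _ _ => by positivity)
    have hik : (i : ℝ) ≤ k := by
      rw [Finset.mem_range] at hi
      exact_mod_cast Nat.lt_succ_iff.1 hi
    exact le_mul_of_one_le_right (Nat.cast_nonneg _)
      (Real.one_le_exp (mul_nonneg ht (by linarith)))
  have h2 : ∑ i ∈ Finset.range (n + 1), (n.choose i : ℝ) * Real.exp (t * (2 * k - 2 * i))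
      = Real.exp (t * (2 * k - n)) * (2 * Real.cosh t) ^ n := by
    rw [Real.cosh_eq, mul_div_cancel₀ _ two_ne_zero, add_comm (Real.exp t), add_pow,
      Finset.mul_sum]
    refine Finset.sum_congr rfl fun i hi => ?_
    have hin : i ≤ n := Nat.lt_succ_iff.1 (Finset.mem_range.1 hi)
    rw [← Real.exp_nat_mul, ← Real.exp_nat_mul, ← mul_assoc, ← mul_assoc, ← Real.exp_add,
      ← Real.exp_add, mul_comm, Nat.cast_sub hin]
    congr 2
    ring
  refine h1.trans (h2.le.trans ?_)
  rw [mul_pow, Real.exp_add, mul_left_comm, show n * t ^ 2 / 2 = n * (t ^ 2 / 2) by ring,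
    Real.exp_nat_mul]
  have := Real.cosh_pos t
  gcongr
  exact Real.cosh_le_exp_half_sq t

theorem vol_add_vol {m d : ℕ} (h : d < m) : vol m d + vol m (m - d - 1) = 2 ^ m := by
  rw [← Nat.sum_range_choose, vol, vol, show m + 1 = d + 1 + (m - d) by omega,
    Finset.sum_range_add _ (d + 1) (m - d), show m - d - 1 + 1 = m - d by omega,
    ← Finset.sum_range_reflect _ (m - d)]
  congr 1
  refine Finset.sum_congr rfl fun i hi => ?_
  rw [Finset.mem_range] at hi
  rw [← Nat.choose_symm (show m - d - 1 - i ≤ m by omega)]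
  congr 1
  omega

theorem vol_self {m d : ℕ} (h : m ≤ d) : vol m d = 2 ^ m := by
  rw [← Nat.sum_range_choose, vol]
  refine (Finset.sum_subset (Finset.range_subset_range.2 (by omega)) fun i _ hi => ?_).symm
  exact Nat.choose_eq_zero_of_lt (by rw [Finset.mem_range] at hi; omega)

/-- Rate bounded away from one keeps the degree within a constant number of standard deviations
of the middle. -/
theorem degree_le {m d : ℕ} (hm : 0 < m) {R : ℝ} (hR : R < 1) (h : RMrate m d ≤ R) :
    (2 * d - m : ℝ) ≤ (1 / 2 - Real.log (1 - R)) * √m := by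
  rw [RMrate_eq, div_le_iff₀ (by positivity)] at h
  have hdm : d < m := by
    by_contra! hdm
    rw [vol_self hdm] at h
    push_cast at h
    have : (0 : ℝ) < 2 ^ m := by positivity
    nlinarith
  have hs : 0 < √(m : ℝ) := Real.sqrt_pos.2 (Nat.cast_pos.2 hm)
  have h1 := vol_le_exp m (m - d - 1) (one_div_pos.2 hs).le
  have h2 : (vol m d : ℝ) + vol m (m - d - 1) = 2 ^ m := mod_cast vol_add_vol hdm
  have h3 : (1 - R) * 2 ^ m ≤ Real.exp (1 / √m * (2 * ↑(m - d - 1) - m) + m * (1 / √m) ^ 2 / 2)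
      * 2 ^ m := by linarith
  have h4 := le_of_mul_le_mul_right h3 (by positivity)
  rw [← Real.log_le_iff_le_exp (by linarith), Nat.cast_sub (by omega), Nat.cast_sub hdm.le] at h4
  have h5 : (m : ℝ) * (1 / √m) ^ 2 / 2 = 1 / 2 := by
    rw [div_pow, Real.sq_sqrt (Nat.cast_nonneg m)]
    have : (m : ℝ) ≠ 0 := by positivity
    field_simp
  rw [h5] at h4
  have h6 : 1 / √(m : ℝ) * (2 * (m - d - (1 : ℕ)) - m) ≤ - ((2 * d - m) / √m) := by
    rw [← neg_div, one_div_mul_eq_div]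
    refine div_le_div_of_nonneg_right ?_ hs.le
    push_cast
    linarith
  rw [← div_le_iff₀ hs]
  linarith

theorem centralBinom_sq_mul_le (k : ℕ) : k.centralBinom ^ 2 * (2 * k + 1) ≤ 16 ^ k := by
  induction k with
  | zero => simp
  | succ k ih =>
    have h := Nat.succ_mul_centralBinom_succ k
    refine le_of_mul_le_mul_left (a := (k + 1) ^ 2) ?_ (by positivity)
    calc (k + 1) ^ 2 * ((k + 1).centralBinom ^ 2 * (2 * (k + 1) + 1))
        = ((k + 1) * (k + 1).centralBinom) ^ 2 * (2 * k + 3) := by ring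
      _ = (k.centralBinom ^ 2 * (2 * k + 1)) * (4 * (2 * k + 1) * (2 * k + 3)) := by rw [h]; ring
      _ ≤ 16 ^ k * (16 * (k + 1) ^ 2) := Nat.mul_le_mul ih (by nlinarith)
      _ = _ := by ring

theorem choose_sq_mul_le (n d : ℕ) : n.choose d ^ 2 * n ≤ 4 ^ n := by
  refine (Nat.mul_le_mul_right n (Nat.pow_le_pow_left (Nat.choose_le_middle d n) 2)).trans ?_
  obtain ⟨k, rfl | rfl⟩ := Nat.even_or_odd' n
  · have h := centralBinom_sq_mul_le k
    rw [Nat.mul_div_cancel_left _ two_pos, ← Nat.centralBinom_eq_two_mul_choose, pow_mul]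
    exact (Nat.mul_le_mul_left _ (Nat.le_succ _)).trans h
  · have h := centralBinom_sq_mul_le (k + 1)
    rw [show (2 * k + 1) / 2 = k by omega]
    have h2 : (k + 1).centralBinom = 2 * (2 * k + 1).choose k := by
      rw [Nat.centralBinom_eq_two_mul_choose, show 2 * (k + 1) = 2 * k + 1 + 1 by ring,
        Nat.choose_succ_succ, Nat.choose_symm_half]
      ring
    rw [h2] at h
    refine le_of_mul_le_mul_left (a := 4) ?_ (by norm_num)
    calc 4 * ((2 * k + 1).choose k ^ 2 * (2 * k + 1))
        ≤ (2 * (2 * k + 1).choose k) ^ 2 * (2 * (k + 1) + 1) := by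
          rw [mul_pow, ← mul_assoc]; exact Nat.mul_le_mul_left _ (by omega)
      _ ≤ 16 ^ (k + 1) := h
      _ = 4 * 4 ^ (2 * k + 1) := by rw [show (16 : ℕ) = 4 ^ 2 by norm_num, ← pow_mul]; ring

theorem vol_succ_add (n d : ℕ) : vol (n + 1) d + n.choose d = 2 * vol n d := by
  induction d with
  | zero => simp [vol]
  | succ d ih =>
    simp only [vol] at ih ⊢
    rw [Finset.sum_range_succ, Finset.sum_range_succ _ (d + 1), Nat.choose_succ_succ']
    omega

theorem rate_le_rate_succ_add {n : ℕ} (d : ℕ) {q : ℝ} (hq : 0 < q) (h : q ^ 2 ≤ n) :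
    RMrate n d ≤ RMrate (n + 1) d + 1 / (2 * q) := by
  have h1 : (vol (n + 1) d : ℝ) + n.choose d = 2 * vol n d := mod_cast vol_succ_add n d
  have h2 : ((n.choose d : ℝ) * q) ^ 2 ≤ (2 ^ n) ^ 2 := by
    have h3 : (n.choose d : ℝ) ^ 2 * n ≤ 4 ^ n := mod_cast choose_sq_mul_le n d
    rw [← pow_mul, mul_comm n 2, pow_mul, mul_pow]
    norm_num
    exact (mul_le_mul_of_nonneg_left h (by positivity)).trans h3
  have h3 := le_of_sq_le_sq h2 (by positivity)
  rw [RMrate_eq, RMrate_eq, ← sub_le_iff_le_add', pow_succ]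
  have h4 : (vol n d : ℝ) / 2 ^ n - vol (n + 1) d / (2 ^ n * 2) = n.choose d / (2 ^ n * 2) := by
    field_simp
    linarith
  rw [h4, div_le_div_iff₀ (by positivity) (by positivity)]
  linarith

theorem rate_le_rate_add (n d j : ℕ) {q : ℝ} (hq : 0 < q) (h : q ^ 2 ≤ n) :
    RMrate n d ≤ RMrate (n + j) d + j / (2 * q) := by
  induction j with
  | zero => simp
  | succ j ih =>
    have := rate_le_rate_succ_add d hq (n := n + j) (h.trans (by push_cast; linarith [Nat.cast_nonneg (α := ℝ) j]))
    rw [← add_assoc]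
    push_cast
    rw [add_div]
    linarith

end Binomials
section UnionBound

variable {m : ℕ}

theorem wt_le (e : (Fin m → ZMod 2) → ZMod 2) : wt e ≤ 2 ^ m := by
  rw [← card_points m, ← Finset.card_univ]
  exact Finset.card_le_card (Finset.filter_subset _ _)

theorem prod_ite_ne_zero (a b : ℝ) (e : (Fin m → ZMod 2) → ZMod 2) :
    ∏ x, (if e x ≠ 0 then a else b) = a ^ wt e * b ^ (2 ^ m - wt e) := by
  rw [Finset.prod_ite, Finset.prod_const, Finset.prod_const]
  have h := Finset.card_filter_add_card_filter_not (s := Finset.univ) (fun x => e x ≠ 0)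
  rw [Finset.card_univ, card_points] at h
  rw [wt, ← h, Nat.add_sub_cancel_left]

theorem likelihood_le_of_le {p : ℝ} (hp0 : 0 ≤ p) (hp : p ≤ 1 - p) {a b N : ℕ} (hba : b ≤ a)
    (ha : a ≤ N) : p ^ a * (1 - p) ^ (N - a) ≤ p ^ b * (1 - p) ^ (N - b) := by
  rw [show N - b = (a - b) + (N - a) by omega, pow_add, ← mul_assoc]
  refine mul_le_mul_of_nonneg_right ?_ (pow_nonneg (by linarith) _)
  calc p ^ a = p ^ b * p ^ (a - b) := by rw [← pow_add]; congr 1; omega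
    _ ≤ _ := mul_le_mul_of_nonneg_left (pow_le_pow_left₀ hp0 hp _) (pow_nonneg hp0 _)

/-- The Bhattacharyya sum of a codeword on the binary symmetric channel. -/
theorem sum_sqrt_likelihood {p : ℝ} (hp0 : 0 ≤ p) (hp1 : p ≤ 1)
    (c : (Fin m → ZMod 2) → ZMod 2) :
    ∑ e : (Fin m → ZMod 2) → ZMod 2,
        √((p ^ wt e * (1 - p) ^ (2 ^ m - wt e)) * (p ^ wt (e + c) * (1 - p) ^ (2 ^ m - wt (e + c))))
      = √(4 * p * (1 - p)) ^ wt c := by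
  have hq : 0 ≤ 1 - p := by linarith
  have h1 : ∀ e : (Fin m → ZMod 2) → ZMod 2,
      √((p ^ wt e * (1 - p) ^ (2 ^ m - wt e)) * (p ^ wt (e + c) * (1 - p) ^ (2 ^ m - wt (e + c))))
        = ∏ x, √((if e x ≠ 0 then p else 1 - p) * (if e x + c x ≠ 0 then p else 1 - p)) := fun e => by
    rw [← prod_ite_ne_zero, ← prod_ite_ne_zero, ← Finset.prod_mul_distrib, Real.sqrt_prod]
    · rfl
    · intro x _
      split_ifs <;> positivity
  have h2 := Finset.prod_univ_sum (fun _ : Fin m → ZMod 2 => (Finset.univ : Finset (ZMod 2)))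
    fun x a => √((if a ≠ 0 then p else 1 - p) * (if a + c x ≠ 0 then p else 1 - p))
  rw [Fintype.piFinset_univ] at h2
  have h4 := prod_ite_ne_zero √(4 * p * (1 - p)) 1 c
  rw [one_pow, mul_one] at h4
  rw [Finset.sum_congr rfl fun e _ => h1 e, ← h2, ← h4]
  refine Finset.prod_congr rfl fun x _ => ?_
  have h3 : ∀ g : ZMod 2 → ℝ, ∑ a, g a = g 0 + g 1 := fun g => Fin.sum_univ_two g
  rw [h3]
  by_cases hc : c x = 0
  · simp only [hc, add_zero, ne_eq, not_true_eq_false, if_false, one_ne_zero, not_false_eq_true,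
      if_true, Real.sqrt_mul_self hp0, Real.sqrt_mul_self hq]
    ring
  · have hc1 := zmod_two_eq_one hc
    have h11 : (1 : ZMod 2) + 1 = 0 := by decide
    simp only [hc1, h11, zero_add, ne_eq, not_true_eq_false, if_false, one_ne_zero,
      not_false_eq_true, if_true]
    rw [mul_comm (1 - p) p, ← two_mul, show 4 * p * (1 - p) = 2 ^ 2 * (p * (1 - p)) by ring,
      Real.sqrt_mul (sq_nonneg (2 : ℝ)), Real.sqrt_sq zero_le_two]

theorem errProb_le {p : ℝ} (hp0 : 0 ≤ p) (hp1 : p ≤ 1 / 2) (m d : ℕ) :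
    errProb p m d
      ≤ ∑ c ∈ (shortened (RM m d) Finset.univ).erase 0, √(4 * p * (1 - p)) ^ wt c := by
  rw [errProb, Finset.sum_congr rfl fun c _ =>
    (sum_sqrt_likelihood hp0 (by linarith) c).symm, Finset.sum_comm]
  refine Finset.sum_le_sum fun e _ => ?_
  have hq : 0 ≤ 1 - p := by linarith
  split_ifs with h
  · obtain ⟨c, hc, hc0, hw⟩ := h
    rw [mul_one]
    refine le_trans ?_ (Finset.single_le_sum (fun _ _ => Real.sqrt_nonneg _)
      (Finset.mem_erase.2 ⟨hc0, mem_shortened_univ.2 (mem_RM.2 hc)⟩))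
    refine Real.le_sqrt_of_sq_le ?_
    rw [sq]
    exact mul_le_mul_of_nonneg_left (likelihood_le_of_le hp0 (by linarith) hw (wt_le e))
      (by positivity)
  · rw [mul_zero]
    exact Finset.sum_nonneg fun _ _ => Real.sqrt_nonneg _

theorem errProb_nonneg {p : ℝ} (hp0 : 0 ≤ p) (hp1 : p ≤ 1 / 2) (m d : ℕ) :
    0 ≤ errProb p m d := by
  have hq : 0 ≤ 1 - p := by linarith
  exact Finset.sum_nonneg fun e _ => by positivity

end UnionBound
section WeightSplit

variable {m d : ℕ}

theorem two_pow_sub_le {k w : ℕ} (hk : k ≤ m) (h : 2 ^ m < w * 2 ^ k) : 2 ^ (m - k) ≤ w := by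
  rw [← Nat.sub_add_cancel hk, pow_add] at h
  exact (Nat.lt_of_mul_lt_mul_right h).le

theorem sum_high_weight_le {θ₀ θ : ℝ} (h0 : 0 < θ₀) (hθ : θ₀ < θ) (h1 : θ ≤ 1) {ℓ s : ℕ}
    (hs : 2 ≤ s) (hm : ℓ + s ≤ m)
    (hf : rmFail (Real.logb 2 (1 + θ)) m d ≤ (1 / 2) ^ (ℓ + s))
    (hq : 2 * (θ₀ / θ) ^ 2 ^ (s - 2) ≤ 1) :
    ∑ c ∈ (shortened (RM m d) Finset.univ).filter fun c => 2 ^ m < wt c * 2 ^ (ℓ + 2),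
      θ₀ ^ wt c ≤ 2 * (θ₀ / θ) ^ 2 ^ (s - 2) := by
  have hθ0 : 0 < θ := h0.trans hθ
  set q := θ₀ / θ with hqdef
  have hq0 : 0 < q := div_pos h0 hθ0
  have hq1 : q ≤ 1 := (div_le_one hθ0).2 hθ.le
  have h2 : ∀ c ∈ (shortened (RM m d) Finset.univ).filter fun c => 2 ^ m < wt c * 2 ^ (ℓ + 2),
      θ₀ ^ wt c ≤ q ^ 2 ^ (m - ℓ - 2) * θ ^ wt c := fun c hc => by
    have hw := (Finset.mem_filter.1 hc).2
    have hw2 := two_pow_sub_le (by omega) hw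
    rw [← Nat.sub_sub] at hw2
    calc θ₀ ^ wt c = q ^ wt c * θ ^ wt c := by
          rw [← mul_pow, hqdef, div_mul_cancel₀ _ hθ0.ne']
      _ ≤ _ := mul_le_mul_of_nonneg_right (pow_le_pow_of_le_one hq0.le hq1 hw2) (by positivity)
  have h3 : ∑ c ∈ shortened (RM m d) Finset.univ, θ ^ wt c ≤ 2 ^ 2 ^ (m - ℓ - s) := by
    refine (sum_pow_wt_le hθ0.le h1 m d).trans ?_
    rw [← Real.rpow_natCast 2 (2 ^ (m - ℓ - s))]
    refine Real.rpow_le_rpow_of_exponent_le one_le_two ?_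
    calc (2 : ℝ) ^ m * rmFail (Real.logb 2 (1 + θ)) m d ≤ 2 ^ m * (1 / 2) ^ (ℓ + s) := by gcongr
      _ = ((2 ^ (m - ℓ - s) : ℕ) : ℝ) := by
          push_cast
          rw [show (2 : ℝ) ^ m = 2 ^ (m - ℓ - s) * 2 ^ (ℓ + s) by rw [← pow_add]; congr 1; omega,
            mul_assoc, ← mul_pow]
          norm_num
  calc _ ≤ ∑ c ∈ (shortened (RM m d) Finset.univ).filter fun c => 2 ^ m < wt c * 2 ^ (ℓ + 2),
        q ^ 2 ^ (m - ℓ - 2) * θ ^ wt c := Finset.sum_le_sum h2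
    _ ≤ ∑ c ∈ shortened (RM m d) Finset.univ, q ^ 2 ^ (m - ℓ - 2) * θ ^ wt c :=
        Finset.sum_le_sum_of_subset_of_nonneg (Finset.filter_subset _ _)
          fun _ _ _ => by positivity
    _ ≤ q ^ 2 ^ (m - ℓ - 2) * 2 ^ 2 ^ (m - ℓ - s) := by
        rw [← Finset.mul_sum]; gcongr
    _ = (2 * q ^ 2 ^ (s - 2)) ^ 2 ^ (m - ℓ - s) := by
        rw [mul_pow, ← pow_mul, ← pow_add, mul_comm]
        congr 3
        omega
    _ ≤ _ := pow_le_of_le_one (by positivity) hq (by positivity)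

theorem sum_low_weight_le {θ₀ : ℝ} (h0 : 0 ≤ θ₀) (h1 : θ₀ ≤ 1) {J ℓ₀ : ℕ} (hJ : θ₀ ^ J ≤ 1 / 2)
    (hd : d + 4 ≤ m)
    (hE : ∀ ℓ, ℓ₀ ≤ ℓ → ℓ ≤ d →
      J * ((m * ℓ + vol (m - ℓ) (d - ℓ)) * (6 * (m + 1))) ≤ 2 ^ (m - ℓ - 4)) :
    ∑ c ∈ ((shortened (RM m d) Finset.univ).erase 0).filter fun c => wt c * 2 ^ (ℓ₀ + 2) ≤ 2 ^ m,
      θ₀ ^ wt c ≤ (m + 1) * θ₀ ^ 2 ^ (m - d - 4) := by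
  set F := ((shortened (RM m d) Finset.univ).erase 0).filter fun c => wt c * 2 ^ (ℓ₀ + 2) ≤ 2 ^ m
    with hF
  set g : ((Fin m → ZMod 2) → ZMod 2) → ℕ := fun c =>
    Nat.findGreatest (fun ℓ => wt c * 2 ^ (ℓ + 2) ≤ 2 ^ m) d with hg
  have hmem : ∀ c ∈ F, c ≠ 0 ∧ c ∈ RM m d ∧ wt c * 2 ^ (ℓ₀ + 2) ≤ 2 ^ m ∧ ℓ₀ ≤ d := fun c hc => by
    rw [hF, Finset.mem_filter, Finset.mem_erase, mem_shortened_univ] at hc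
    refine ⟨hc.1.1, hc.1.2, hc.2, ?_⟩
    by_contra! h
    exact hc.1.1 (eq_zero_of_low_weight h hc.1.2 hc.2)
  have hmaps : ∀ c ∈ F, g c ∈ Finset.Icc ℓ₀ d := fun c hc => by
    obtain ⟨-, -, hw, hℓ⟩ := hmem c hc
    exact Finset.mem_Icc.2 ⟨Nat.le_findGreatest hℓ hw, Nat.findGreatest_le d⟩
  rw [← Finset.sum_fiberwise_of_maps_to hmaps]
  have hfib : ∀ ℓ ∈ Finset.Icc ℓ₀ d, ∑ c ∈ F.filter fun c => g c = ℓ, θ₀ ^ wt c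
      ≤ θ₀ ^ 2 ^ (m - d - 4) := fun ℓ hℓ => by
    obtain ⟨hℓ0, hℓd⟩ := Finset.mem_Icc.1 hℓ
    set E := (m * ℓ + vol (m - ℓ) (d - ℓ)) * (6 * (m + 1)) with hEdef
    have hcard : ((F.filter fun c => g c = ℓ).card : ℝ) ≤ 2 ^ E := by
      have h2 : (F.filter fun c => g c = ℓ).card ≤ ((shortened (RM m d) Finset.univ).filter
          fun f => wt f * 2 ^ (ℓ + 2) ≤ 2 ^ m).card := Finset.card_le_card fun c hc => by
        obtain ⟨hcF, rfl⟩ := Finset.mem_filter.1 hc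
        obtain ⟨-, hc1, hw, hℓ'⟩ := hmem c hcF
        exact Finset.mem_filter.2 ⟨mem_shortened_univ.2 hc1,
          Nat.findGreatest_spec (P := fun ℓ => wt c * 2 ^ (ℓ + 2) ≤ 2 ^ m) hℓ' hw⟩
      have h3 := h2.trans (card_low_weight_le m d ℓ)
      rw [if_pos hℓd, ← pow_mul] at h3
      exact_mod_cast h3
    have hwt : ∀ c ∈ F.filter fun c => g c = ℓ, θ₀ ^ wt c ≤ θ₀ ^ 2 ^ (m - ℓ - 3) := fun c hc => by
      obtain ⟨hcF, hgc⟩ := Finset.mem_filter.1 hc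
      obtain ⟨hc0, hc1, hw, hℓ'⟩ := hmem c hcF
      refine pow_le_pow_of_le_one h0 h1 ?_
      have h2 : ¬ wt c * 2 ^ (ℓ + 1 + 2) ≤ 2 ^ m := by
        rcases hℓd.lt_or_eq with h | h
        · exact Nat.findGreatest_is_greatest (P := fun ℓ => wt c * 2 ^ (ℓ + 2) ≤ 2 ^ m)
            (hgc.trans_lt (Nat.lt_succ_self ℓ)) h
        · exact fun h3 => hc0 (eq_zero_of_low_weight (by omega) hc1 h3)
      exact two_pow_sub_le (k := ℓ + 3) (by omega) (not_le.1 h2)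
    have h2E : (2 : ℝ) ^ E * θ₀ ^ 2 ^ (m - ℓ - 4) ≤ 1 := by
      calc (2 : ℝ) ^ E * θ₀ ^ 2 ^ (m - ℓ - 4) ≤ 2 ^ E * θ₀ ^ (J * E) := by
            gcongr 2 ^ E * ?_
            exact pow_le_pow_of_le_one h0 h1 (hE ℓ hℓ0 hℓd)
        _ = (2 * θ₀ ^ J) ^ E := by rw [mul_pow, pow_mul θ₀]
        _ ≤ 1 := pow_le_one₀ (by positivity) (by linarith)
    calc _ ≤ (F.filter fun c => g c = ℓ).card • θ₀ ^ 2 ^ (m - ℓ - 3) :=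
          Finset.sum_le_card_nsmul _ _ _ hwt
      _ ≤ 2 ^ E * θ₀ ^ 2 ^ (m - ℓ - 3) := by rw [nsmul_eq_mul]; gcongr
      _ = (2 ^ E * θ₀ ^ 2 ^ (m - ℓ - 4)) * θ₀ ^ 2 ^ (m - ℓ - 4) := by
          rw [mul_assoc, ← pow_add, ← two_mul, ← pow_succ']
          congr 3
          omega
      _ ≤ 1 * θ₀ ^ 2 ^ (m - ℓ - 4) := by gcongr
      _ ≤ θ₀ ^ 2 ^ (m - d - 4) := by
          rw [one_mul]
          exact pow_le_pow_of_le_one h0 h1 (Nat.pow_le_pow_right two_pos (by omega))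
  refine (Finset.sum_le_card_nsmul _ _ _ hfib).trans ?_
  rw [nsmul_eq_mul, Nat.card_Icc]
  refine mul_le_mul_of_nonneg_right ?_ (by positivity)
  exact_mod_cast (show d + 1 - ℓ₀ ≤ m + 1 by omega)

end WeightSplit
section Asymptotics

open Filter

theorem vol_shifted_le {m d r b J ℓ : ℕ} {c : ℝ} (hc : (2 * d - m : ℝ) ≤ c * √m) (hc0 : 0 ≤ c)
    (hbr : b ≤ r) (hr : 2 ≤ r) (hm : m < 16 ^ (r + 1)) (hℓ : (r - 2) * 4 ^ (r - b + 1) ≤ ℓ)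
    (hℓd : ℓ ≤ d) (hdm : d + 5 ≤ m)
    (hK : J * 6 * 16 ^ (r + 1) * Real.exp (6 * 4 ^ b * c + (6 * 4 ^ b) ^ 2 / 2 - 6 * (r - 2))
      ≤ 1 / 32) :
    J * (vol (m - ℓ) (d - ℓ) * (6 * (m + 1))) ≤ 2 ^ (m - ℓ - 5) := by
  have hq : (0 : ℝ) < 4 ^ (r + 1) := by positivity
  set t : ℝ := 6 * 4 ^ b / 4 ^ (r + 1) with ht
  have ht0 : 0 ≤ t := by positivity
  have htq : t * 4 ^ (r + 1) = 6 * 4 ^ b := div_mul_cancel₀ _ hq.ne'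
  have h16 : ((16 : ℝ) ^ (r + 1)) = (4 ^ (r + 1)) ^ 2 := by
    rw [← pow_mul, mul_comm, pow_mul]; norm_num
  have hm1 : (m : ℝ) + 1 ≤ 16 ^ (r + 1) := mod_cast hm
  have hsq : √(m : ℝ) ≤ 4 ^ (r + 1) := by
    rw [Real.sqrt_le_left hq.le, ← h16]; linarith
  have h1 : t * (c * √m) ≤ 6 * 4 ^ b * c := by
    calc t * (c * √m) ≤ t * (c * 4 ^ (r + 1)) := by gcongr
      _ = t * 4 ^ (r + 1) * c := by ring
      _ = _ := by rw [htq]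
  have h2 : (m : ℝ) * t ^ 2 / 2 ≤ (6 * 4 ^ b) ^ 2 / 2 := by
    rw [← htq, mul_pow, ← h16, mul_comm]
    gcongr
    linarith
  have h3 : 6 * ((r : ℝ) - 2) ≤ t * ℓ := by
    have hℓ' : ((r : ℝ) - 2) * 4 ^ (r - b + 1) ≤ ℓ := by
      rw [← Nat.cast_ofNat, ← Nat.cast_sub hr]
      exact_mod_cast hℓ
    calc 6 * ((r : ℝ) - 2) = t * ((r - 2) * 4 ^ (r - b + 1)) := by
          rw [ht, show r + 1 = b + (r - b + 1) by omega, pow_add]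
          field_simp
      _ ≤ _ := by gcongr
  have h4 := vol_le_exp (m - ℓ) (d - ℓ) ht0
  rw [Nat.cast_sub hℓd, Nat.cast_sub (by omega : ℓ ≤ m)] at h4
  have h5 : t * (2 * ((d : ℝ) - ℓ) - (m - ℓ)) + (m - ℓ) * t ^ 2 / 2
      ≤ 6 * 4 ^ b * c + (6 * 4 ^ b) ^ 2 / 2 - 6 * (r - 2) := by
    have h6 := mul_le_mul_of_nonneg_left hc ht0
    have h7 : 0 ≤ (ℓ : ℝ) * t ^ 2 := by positivity
    nlinarith
  have h6 : (J : ℝ) * (vol (m - ℓ) (d - ℓ) * (6 * (m + 1))) ≤ 2 ^ (m - ℓ - 5) := by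
    calc (J : ℝ) * (vol (m - ℓ) (d - ℓ) * (6 * (m + 1)))
        ≤ J * ((2 ^ (m - ℓ) * Real.exp (6 * 4 ^ b * c + (6 * 4 ^ b) ^ 2 / 2 - 6 * (r - 2)))
            * (6 * 16 ^ (r + 1))) := by
          gcongr
          exact h4.trans (by gcongr)
      _ = 2 ^ (m - ℓ) * (J * 6 * 16 ^ (r + 1)
            * Real.exp (6 * 4 ^ b * c + (6 * 4 ^ b) ^ 2 / 2 - 6 * (r - 2))) := by ring
      _ ≤ 2 ^ (m - ℓ) * (1 / 32) := by gcongr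
      _ = _ := by
          rw [show m - ℓ = (m - ℓ - 5) + 5 by omega, pow_add, Nat.add_sub_cancel]
          ring
  exact_mod_cast h6

theorem rmFail_le_of_rate {l a b η R₁ ρ : ℝ} (h : IsBias l a b) (hρ0 : 0 < ρ) (hρ1 : ρ ≤ 1)
    (hs : IsSmallNoise l a b ρ) (hη : 0 < η) (hR0 : 0 ≤ R₁) (hR : R₁ + η + η ≤ 1 - l)
    {m d r β : ℕ} (hβ : 2 ≤ β) (hβr : β ≤ r) (hβη : 8 / 4 ^ β ≤ η) (hm : 16 ^ r ≤ m)
    (hu : (1 / 2) ^ 4 ^ (r - β) / η ≤ (1 / 2) ^ r * ρ ^ 2 ^ r) (hd : RMrate m d ≤ R₁) :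
    rmFail l m d ≤ (1 / 2) ^ ((r - 1) * 4 ^ (r - β + 1)) := by
  have hl0 := h.pos
  have hl1 := h.lt_one
  obtain ⟨k, rfl⟩ : ∃ k, r = k + 1 := ⟨r - 1, by omega⟩
  set u := 4 ^ (k + 1 - β) with hudef
  have hs16 : 4 * u * 4 ≤ 4 ^ (k + 1) := by
    rw [hudef, show k + 1 = (k + 1 - β) + (β - 2) + 2 by omega, pow_add, pow_add,
      show (k + 1 - β) + (β - 2) + 2 - β = k + 1 - β by omega]
    have : 1 ≤ 4 ^ (β - 2) := Nat.one_le_pow _ _ (by norm_num)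
    nlinarith [Nat.zero_le (4 ^ (k + 1 - β))]
  have h4 : 4 ^ (k + 1) * 4 ^ (k + 1) ≤ m := by
    rw [← mul_pow]; exact hm
  have h41 : 1 ≤ 4 ^ (k + 1) := Nat.one_le_pow _ _ (by norm_num)
  have h2s : 2 * (2 * (4 * u)) ≤ m := by nlinarith
  obtain ⟨n, rfl⟩ : ∃ n, m = n + 2 * (4 * u) := ⟨m - 2 * (4 * u), by omega⟩
  have hrate : RMrate n d ≤ R₁ + η := by
    have hq : ((4 : ℝ) ^ (k + 1) / 2) ^ 2 ≤ n := by
      have h5 : (4 : ℝ) ^ (k + 1) * 4 ^ (k + 1) ≤ (n + 2 * (4 * u) : ℕ) := mod_cast h4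
      have h6 : ((2 * (2 * (4 * u)) : ℕ) : ℝ) ≤ (n + 2 * (4 * u) : ℕ) := mod_cast h2s
      push_cast at h5 h6
      nlinarith
    have h5 := rate_le_rate_add n d (2 * (4 * u)) (by positivity) hq
    refine h5.trans (add_le_add hd (le_trans (le_of_eq ?_) hβη))
    rw [hudef]
    push_cast
    rw [mul_div_cancel₀ _ two_ne_zero, div_eq_div_iff (by positivity) (by positivity),
      show (4 : ℝ) ^ (k + 1) = 4 ^ (k + 1 - β) * 4 ^ β by rw [← pow_add]; congr 1; omega]
    ring
  have hκ : rmFail l n d ≤ 1 - η := by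
    have h5 := (mul_rmFail_le_rate hl0.le hl1.le n d).trans hrate
    have h6 : (1 - l) * rmFail l n d ≤ (1 - l) * (1 - η) := by nlinarith
    exact le_of_mul_le_mul_left h6 (by linarith)
  have := rmFail_amplify h hρ0 hρ1 hs hη (by linarith) hκ hu
  rwa [Nat.add_sub_cancel, pow_succ, mul_comm (4 ^ (k + 1 - β)) 4]

end Asymptotics
section Main

open Filter Topology

theorem tendsto_log_sixteen : Tendsto (fun m => Nat.log 16 m) atTop atTop :=
  tendsto_atTop.2 fun b => (eventually_ge_atTop (16 ^ b)).mono fun _ hm =>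
    Nat.le_log_of_pow_le (by norm_num) hm

theorem eventually_pow_four_bound {η : ℝ} (hη : 0 < η) (a β : ℕ) :
    ∀ᶠ r : ℕ in atTop,
      (1 / 2 : ℝ) ^ 4 ^ (r - β) / η ≤ (1 / 2) ^ r * ((1 / 2) ^ a) ^ 2 ^ r := by
  obtain ⟨C, hC⟩ := exists_pow_lt_of_lt_one hη (show (1 / 2 : ℝ) < 1 by norm_num)
  filter_upwards [eventually_ge_atTop ((a + 1 + C) * 4 ^ β), eventually_ge_atTop β] with r hr hβ
  have h1 : r < 2 ^ r := Nat.lt_two_pow_self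
  have h2 : (a + 1 + C) * 2 ^ r ≤ 4 ^ (r - β) := by
    refine Nat.le_of_mul_le_mul_right (c := 4 ^ β) ?_ (by positivity)
    rw [← pow_add, Nat.sub_add_cancel hβ, show 4 ^ r = 2 ^ r * 2 ^ r by rw [← mul_pow]; norm_num,
      mul_right_comm]
    exact Nat.mul_le_mul_right _ (hr.trans h1.le)
  have h3 : r + a * 2 ^ r + C ≤ 4 ^ (r - β) := by nlinarith [Nat.zero_le C]
  rw [div_le_iff₀ hη, ← pow_mul, ← pow_add]
  calc (1 / 2 : ℝ) ^ 4 ^ (r - β) ≤ (1 / 2) ^ (r + a * 2 ^ r + C) :=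
        pow_le_pow_of_le_one (by norm_num) (by norm_num) h3
    _ = (1 / 2) ^ (r + a * 2 ^ r) * (1 / 2) ^ C := pow_add _ _ _
    _ ≤ _ := by gcongr

theorem eventually_high_weight_bound {q δ : ℝ} (hq0 : 0 ≤ q) (hq1 : q < 1) (hδ : 0 < δ) (β : ℕ) :
    ∀ᶠ r : ℕ in atTop, 2 * q ^ 2 ^ (4 ^ (r - β + 1) - 2) ≤ δ := by
  have h1 : Tendsto (fun r : ℕ => 2 ^ (4 ^ (r - β + 1) - 2)) atTop atTop := by
    refine tendsto_atTop_mono (fun r => ?_) (tendsto_sub_atTop_nat (β + 2))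
    have h2 : 4 ^ (r - β + 1) - 2 < 2 ^ (4 ^ (r - β + 1) - 2) := Nat.lt_two_pow_self
    have h3 : r - β + 1 < 4 ^ (r - β + 1) := Nat.lt_pow_self (by norm_num)
    omega
  have h2 := ((tendsto_pow_atTop_nhds_zero_of_lt_one hq0 hq1).comp h1).const_mul 2
  rw [mul_zero] at h2
  exact (h2.eventually_lt_const hδ).mono fun r hr => hr.le

theorem eventually_exp_bound (K X : ℝ) :
    ∀ᶠ r : ℕ in atTop, K * 16 ^ (r + 1) * Real.exp (X - 6 * (r - 2)) ≤ 1 / 32 := by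
  have h1 : 16 * Real.exp (-6) < 1 := by
    have h2 : (2 : ℝ) ^ 6 ≤ Real.exp 6 := by
      have := Real.add_one_le_exp (1 : ℝ)
      calc (2 : ℝ) ^ 6 ≤ Real.exp 1 ^ 6 := pow_le_pow_left₀ (by norm_num) (by linarith) 6
        _ = Real.exp 6 := by rw [← Real.exp_nat_mul]; norm_num
    rw [Real.exp_neg, ← div_eq_mul_inv, div_lt_one (Real.exp_pos 6)]
    norm_num at h2
    linarith
  have h2 := (tendsto_pow_atTop_nhds_zero_of_lt_one (by positivity) h1).const_mul
    (K * 16 * Real.exp (X + 12))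
  rw [mul_zero] at h2
  filter_upwards [h2.eventually_lt_const (show (0 : ℝ) < 1 / 32 by norm_num)] with r hr
  refine le_trans (le_of_eq ?_) hr.le
  rw [mul_pow, ← Real.exp_nat_mul, pow_succ,
    show X - 6 * ((r : ℝ) - 2) = (X + 12) + r * (-6) by ring, Real.exp_add]
  ring

theorem tendsto_div_four : Tendsto (fun m : ℕ => m / 4) atTop atTop :=
  Nat.tendsto_div_const_atTop (by norm_num)

theorem eventually_cubic_le (J : ℕ) : ∀ᶠ m : ℕ in atTop,
    J * (m * m * (6 * (m + 1))) ≤ 2 ^ (m / 4) := by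
  have h1 := ((tendsto_pow_const_mul_const_pow_of_abs_lt_one 3
    (show |(1 / 2 : ℝ)| < 1 by norm_num [abs_of_pos])).comp (tendsto_add_atTop_nat 1)).const_mul
    ((J : ℝ) * 6 * 64)
  rw [mul_zero] at h1
  filter_upwards [tendsto_div_four.eventually
    (h1.eventually_lt_const (show (0 : ℝ) < 1 / 2 by norm_num))] with m hm
  set w := m / 4 with hw
  have h2 : m + 1 ≤ 4 * (w + 1) := by omega
  have h3 : J * 6 * 64 * (w + 1) ^ 3 ≤ 2 ^ w := by
    have h4 : (J : ℝ) * 6 * 64 * (w + 1) ^ 3 ≤ 2 ^ w := by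
      simp only [Function.comp] at hm
      push_cast at hm
      rw [one_div_pow, pow_succ 2 w] at hm
      have h5 : (0 : ℝ) < 2 ^ w := by positivity
      field_simp at hm
      linarith
    exact_mod_cast h4
  calc J * (m * m * (6 * (m + 1)))
      ≤ J * ((4 * (w + 1)) * (4 * (w + 1)) * (6 * (4 * (w + 1)))) := by gcongr <;> omega
    _ = J * 6 * 64 * (w + 1) ^ 3 := by ring
    _ ≤ _ := h3

theorem eventually_low_weight_bound {θ₀ δ : ℝ} (h0 : 0 ≤ θ₀) (h1 : θ₀ < 1) (hδ : 0 < δ) :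
    ∀ᶠ m : ℕ in atTop, (m + 1) * θ₀ ^ 2 ^ (m / 4) ≤ δ := by
  have h2 := ((tendsto_self_mul_const_pow_of_lt_one h0 h1).comp (tendsto_add_atTop_nat 1)).const_mul
    (4 : ℝ)
  rw [mul_zero] at h2
  filter_upwards [tendsto_div_four.eventually (h2.eventually_lt_const hδ)] with m hm
  refine le_trans ?_ hm.le
  have h3 : ((m + 1 : ℕ) : ℝ) ≤ (4 * (m / 4 + 1) : ℕ) := Nat.cast_le.2 (by omega)
  have h4 : m / 4 + 1 ≤ 2 ^ (m / 4) := Nat.lt_two_pow_self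
  rw [Nat.cast_mul] at h3
  calc ((m : ℝ) + 1) * θ₀ ^ 2 ^ (m / 4) ≤ ((4 : ℕ) * ((m / 4 + 1 : ℕ) : ℝ)) * θ₀ ^ (m / 4 + 1) :=
        mul_le_mul (by exact_mod_cast h3) (pow_le_pow_of_le_one h0 h1.le h4) (by positivity)
          (by positivity)
    _ = _ := by simp only [Function.comp]; push_cast; ring

/-- Union bound sum over nonzero codewords: it vanishes uniformly in the degree below the
threshold rate. -/
theorem eventually_sum_pow_wt_le {θ₀ R₁ ε : ℝ} (h0 : 0 < θ₀) (h1 : θ₀ < 1) (hR0 : 0 ≤ R₁)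
    (hR : R₁ < 1 - Real.logb 2 (1 + θ₀)) (hε : 0 < ε) :
    ∀ᶠ m : ℕ in atTop, ∀ d, RMrate m d ≤ R₁ →
      ∑ c ∈ (shortened (RM m d) Finset.univ).erase 0, θ₀ ^ wt c ≤ ε := by
  obtain ⟨θ, hθ0, hθ1, hθR⟩ : ∃ θ, θ₀ < θ ∧ θ < 1 ∧ R₁ < 1 - Real.logb 2 (1 + θ) := by
    have hc : ContinuousAt (fun θ => 1 - Real.logb 2 (1 + θ)) θ₀ :=
      continuousAt_const.sub ((continuousAt_const.add continuousAt_id).logb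
        (ne_of_gt (add_pos one_pos h0)))
    have h2 := (hc.eventually (eventually_gt_nhds hR)).filter_mono
      (nhdsWithin_le_nhds (s := Set.Ioi θ₀))
    obtain ⟨θ, hθ⟩ := (h2.and (Ioo_mem_nhdsGT h1)).exists
    exact ⟨θ, hθ.2.1, hθ.2.2, hθ.1⟩
  have hθpos : 0 < θ := h0.trans hθ0
  set l := Real.logb 2 (1 + θ) with hl
  have hl0 : 0 < l := Real.logb_pos one_lt_two (by linarith)
  have hl1 : l < 1 := by linarith
  obtain ⟨x, y, hxy⟩ := exists_isBias hl0 hl1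
  obtain ⟨a, ha⟩ := exists_isSmallNoise l x y
  set η := (1 - l - R₁) / 2 with hη
  have hη0 : 0 < η := by linarith
  obtain ⟨β, hβ2, hβη⟩ : ∃ β : ℕ, 2 ≤ β ∧ 8 / (4 : ℝ) ^ β ≤ η := by
    have h2 := (tendsto_pow_atTop_nhds_zero_of_lt_one (show (0 : ℝ) ≤ 1 / 4 by norm_num)
      (by norm_num)).const_mul 8
    rw [mul_zero] at h2
    obtain ⟨β, hβ, hβ2⟩ := ((h2.eventually_lt_const hη0).and (eventually_ge_atTop 2)).exists
    refine ⟨β, hβ2, le_trans (le_of_eq ?_) hβ.le⟩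
    rw [one_div_pow, mul_one_div]
  obtain ⟨J, hJ⟩ := exists_pow_lt_of_lt_one (show (0 : ℝ) < 1 / 2 by norm_num) h1
  set c := 1 / 2 - Real.log (1 - R₁) with hc
  have hc0 : 0 ≤ c := by
    have := Real.log_nonpos (show 0 ≤ 1 - R₁ by linarith) (by linarith)
    linarith
  have hq0 : 0 ≤ θ₀ / θ := by positivity
  have hq1 : θ₀ / θ < 1 := (div_lt_one hθpos).2 hθ0
  have hsqrt : ∀ᶠ m : ℕ in atTop, c ≤ √(m : ℝ) / 4 :=
    ((Real.tendsto_sqrt_atTop.comp tendsto_natCast_atTop_atTop).atTop_div_const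
      (by norm_num : (0 : ℝ) < 4)).eventually_ge_atTop c
  filter_upwards [hsqrt, eventually_cubic_le J, eventually_low_weight_bound h0.le h1 (half_pos hε),
    eventually_ge_atTop 40, tendsto_log_sixteen.eventually (eventually_ge_atTop β),
    tendsto_log_sixteen.eventually (eventually_pow_four_bound hη0 a β),
    tendsto_log_sixteen.eventually
      (eventually_high_weight_bound hq0 hq1 (lt_min one_pos (half_pos hε)) β),
    tendsto_log_sixteen.eventually
      (eventually_exp_bound (J * 6) (6 * 4 ^ β * c + (6 * 4 ^ β) ^ 2 / 2))]
    with m hmc hcubic hlow hm40 hβr hpow hhigh hexp d hrate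
  set r := Nat.log 16 m
  have hrm : 16 ^ r ≤ m := Nat.pow_log_le_self 16 (by omega)
  have hmr : m < 16 ^ (r + 1) := Nat.lt_pow_succ_log_self (by norm_num) m
  set s := 4 ^ (r - β + 1) with hs
  have hdeg : (2 * d - m : ℝ) ≤ c * √m := degree_le (by omega) (by linarith) hrate
  have hdm : m / 4 ≤ m - d - 5 ∧ d + 5 ≤ m := by
    have h2 : c * √(m : ℝ) ≤ m / 4 := by
      calc c * √(m : ℝ) ≤ √m / 4 * √m := by gcongr
        _ = m / 4 := by rw [div_mul_eq_mul_div, Real.mul_self_sqrt (Nat.cast_nonneg m)]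
    have h3 : (8 * d : ℝ) ≤ 5 * m := by linarith
    have h4 : 8 * d ≤ 5 * m := by exact_mod_cast h3
    omega
  have hs2 : 2 ≤ s := by
    rw [hs, pow_succ]
    have : 1 ≤ 4 ^ (r - β) := Nat.one_le_pow _ _ (by norm_num)
    omega
  have hsplit : (r - 2) * s + s = (r - 1) * s := by
    rw [show r - 1 = r - 2 + 1 by omega, Nat.succ_mul]
  have hsm : (r - 2) * s + s ≤ m := by
    have h2 : s ≤ 4 ^ r := Nat.pow_le_pow_right (by norm_num) (by omega)
    have h3 : r < 4 ^ r := Nat.lt_pow_self (by norm_num)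
    have h4 : 4 ^ r * 4 ^ r ≤ m := by rw [← mul_pow]; exact hrm
    rw [hsplit]
    exact (Nat.mul_le_mul (by omega) h2).trans h4
  have hfail : rmFail l m d ≤ (1 / 2) ^ ((r - 2) * s + s) := by
    rw [hsplit]
    exact rmFail_le_of_rate hxy (by positivity) (pow_le_one₀ (by norm_num) (by norm_num)) ha hη0
      hR0 (by linarith) hβ2 hβr hβη hrm hpow hrate
  have hH := sum_high_weight_le h0 hθ0 hθ1.le hs2 hsm hfail (hhigh.trans (min_le_left _ _))
  have hL := sum_low_weight_le (ℓ₀ := (r - 2) * s) h0.le h1.le hJ.le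
    (show d + 4 ≤ m by omega) fun ℓ hℓ hℓd => by
      have h2 := vol_shifted_le hdeg hc0 hβr (hβ2.trans hβr) hmr hℓ hℓd hdm.2 hexp
      have h3 : J * (m * ℓ * (6 * (m + 1))) ≤ 2 ^ (m - ℓ - 5) := by
        calc J * (m * ℓ * (6 * (m + 1))) ≤ J * (m * m * (6 * (m + 1))) := by
              gcongr; omega
          _ ≤ 2 ^ (m / 4) := hcubic
          _ ≤ _ := Nat.pow_le_pow_right two_pos (by omega)
      rw [show m - ℓ - 4 = m - ℓ - 5 + 1 by omega, pow_succ, add_mul, mul_add]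
      omega
  have hsum : ∑ c ∈ (shortened (RM m d) Finset.univ).erase 0, θ₀ ^ wt c
      ≤ 2 * (θ₀ / θ) ^ 2 ^ (s - 2) + (m + 1) * θ₀ ^ 2 ^ (m - d - 4) := by
    rw [← Finset.sum_filter_add_sum_filter_not _ fun c => 2 ^ m < wt c * 2 ^ ((r - 2) * s + 2)]
    refine add_le_add (le_trans ?_ hH) ?_
    · exact Finset.sum_le_sum_of_subset_of_nonneg
        (Finset.filter_subset_filter _ (Finset.erase_subset _ _)) fun _ _ _ => by positivity
    · simp only [not_lt]
      exact hL
  have hlow' : ((m : ℝ) + 1) * θ₀ ^ 2 ^ (m - d - 4) ≤ ε / 2 := by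
    refine le_trans (mul_le_mul_of_nonneg_left ?_ (by positivity)) hlow
    exact pow_le_pow_of_le_one h0.le h1.le (Nat.pow_le_pow_right two_pos (by omega))
  linarith [hhigh.trans (min_le_right _ _)]

theorem RMrate_le_one (m d : ℕ) : RMrate m d ≤ 1 := by
  rw [RMrate_eq, div_le_one (by positivity)]
  have h : vol m d ≤ 2 ^ m := by
    rcases lt_or_ge d m with h | h
    · rw [← vol_add_vol h]; exact Nat.le_add_right _ _
    · exact (vol_self h).le
  exact_mod_cast h

theorem eventually_errProb_le {p R₁ ε : ℝ} (hp0 : 0 < p) (hp1 : p < 1 / 2) (hR0 : 0 ≤ R₁)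
    (hR : R₁ < 1 - Real.logb 2 (1 + √(4 * p * (1 - p)))) (hε : 0 < ε) :
    ∀ᶠ m : ℕ in atTop, ∀ d, RMrate m d ≤ R₁ → errProb p m d ≤ ε := by
  have hpos : 0 < 4 * p * (1 - p) := mul_pos (by linarith) (by linarith)
  have hlt : √(4 * p * (1 - p)) < 1 := by
    rw [Real.sqrt_lt' one_pos]
    nlinarith [mul_pos (show 0 < 1 / 2 - p by linarith) (show 0 < 1 / 2 - p by linarith)]
  exact (eventually_sum_pow_wt_le (Real.sqrt_pos.2 hpos) hlt hR0 hR hε).mono fun m hm d hd =>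
    (errProb_le hp0.le hp1.le m d).trans (hm d hd)

end Main
end RMBSC

/-- **Proposition (Reed-Muller codes achieve capacity-type bound on BSC(p)).**
Fix `0 < p < 1/2` and `0 < R < 1` with `R < 1 - log₂(1 + √(4p(1-p)))`. For any sequence
of Reed-Muller codes `RM(m_k, d_k)` with `m_k → ∞` and `limsup_k rate ≤ R`, the error
probability on `BSC(p)` tends to `0`. -/
theorem RM_decodes_BSC (p R : ℝ) (hp0 : 0 < p) (hp1 : p < 1 / 2)
    (hR0 : 0 < R) (hR1 : R < 1)
    (hR : R < 1 - Real.logb 2 (1 + Real.sqrt (4 * p * (1 - p))))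
    (m d : ℕ → ℕ) (hm : Filter.Tendsto m Filter.atTop Filter.atTop)
    (hrate : Filter.limsup (fun k => RMrate (m k) (d k)) Filter.atTop ≤ R) :
    Filter.Tendsto (fun k => errProb p (m k) (d k)) Filter.atTop (nhds 0) := by
  obtain ⟨R₁, hRR₁, hR₁⟩ := exists_between hR
  have hbdd : Filter.IsBoundedUnder (· ≤ ·) Filter.atTop fun k => RMrate (m k) (d k) :=
    Filter.isBoundedUnder_of ⟨1, fun k => RMBSC.RMrate_le_one (m k) (d k)⟩
  have hev := Filter.eventually_lt_of_limsup_lt (hrate.trans_lt hRR₁) hbdd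
  rw [Metric.tendsto_nhds]
  intro ε hε
  filter_upwards [hev, hm.eventually (RMBSC.eventually_errProb_le hp0 hp1 (hR0.trans hRR₁).le hR₁
    (half_pos hε))] with k hk hk2
  rw [Real.dist_0_eq_abs, abs_of_nonneg (RMBSC.errProb_nonneg hp0.le hp1.le (m k) (d k))]
  linarith [hk2 (d k) hk.le]
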